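/- Equivalence of Paraconsistent Non-dependence Logic with universal second-order logic Π¹₁ at the level of sentences: (1) for every Dependence Logic sentence φ over a signature Σ there exist finitely many new relation symbols R⃗ and a first-order sentence Ψ over Σ ∪ {R⃗} such that for all models M of Σ: M ⊨ₚ⁺ φ if and only if (M, S⃗) ⊨ Ψ for every interpretation S⃗ of the symbols R⃗ in M; and (2) conversely, for every finite tuple of relation symbols R⃗ and first-order sentence Ψ over Σ ∪ {R⃗} there exists a Dependence Logic sentence φ over Σ such that for all models M of Σ: M ⊨ₚ⁺ φ if and only if (M, S⃗) ⊨ Ψ for every interpretation S⃗ of R⃗ in M. -/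

import Mathlib

/-! ## Dependence Logic: syntax, Tarski semantics, Team Semantics,
    Paraconsistent Team Semantics.

Variable assignments are total functions `ℕ → M.Dom`, so every team has
domain the set of all variables, and conditions like `Free(ψ) ⊆ Dom(X)`
hold automatically. The team `{∅}` consisting of the empty assignment is
represented by the singleton team of a fixed (arbitrary) assignment. -/

/-- A first-order signature: relation and function symbols with arities. -/
structure Signature : Type 1 where
  Rel : Type
  relArity : Rel → ℕ
  Func : Type
  funcArity : Func → ℕ

/-- First-order terms over a signature, with variables indexed by `ℕ`. -/
inductive Term (Sig : Signature) : Type where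
  | var : ℕ → Term Sig
  | func : (f : Sig.Func) → (Fin (Sig.funcArity f) → Term Sig) → Term Sig

/-- A first-order model for a signature (with nonempty domain). -/
structure Model (Sig : Signature) : Type 1 where
  Dom : Type
  nonempty : Nonempty Dom
  relInterp : (R : Sig.Rel) → (Fin (Sig.relArity R) → Dom) → Prop
  funcInterp : (f : Sig.Func) → (Fin (Sig.funcArity f) → Dom) → Dom

variable {Sig : Signature}

/-- Evaluation of a term under an assignment. -/
def Term.eval (M : Model Sig) (s : ℕ → M.Dom) : Term Sig → M.Dom
  | .var v => s v
  | .func f ts => M.funcInterp f (fun i => (ts i).eval M s)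

/-- The set of variables occurring in a term. -/
def Term.vars : Term Sig → Set ℕ
  | .var v => {v}
  | .func _ ts => ⋃ i, (ts i).vars

/-- Formulas of Dependence Logic: first-order atoms `R t⃗` and `t₁ = t₂`,
dependence atoms `=(t⃗₁, t⃗₂)`, negation, disjunction, existential
quantification. -/
inductive DLFormula (Sig : Signature) : Type where
  | rel : (R : Sig.Rel) → (Fin (Sig.relArity R) → Term Sig) → DLFormula Sig
  | eq : Term Sig → Term Sig → DLFormula Sig
  | dep : (n m : ℕ) → (Fin n → Term Sig) → (Fin m → Term Sig) → DLFormula Sig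
  | neg : DLFormula Sig → DLFormula Sig
  | or : DLFormula Sig → DLFormula Sig → DLFormula Sig
  | ex : ℕ → DLFormula Sig → DLFormula Sig

/-- `ψ ∧ θ` abbreviates `¬(¬ψ ∨ ¬θ)`. -/
def DLFormula.conj (ψ θ : DLFormula Sig) : DLFormula Sig := (ψ.neg.or θ.neg).neg

/-- `∀v ψ` abbreviates `¬∃v ¬ψ`. -/
def DLFormula.all (v : ℕ) (ψ : DLFormula Sig) : DLFormula Sig := ((ψ.neg).ex v).neg

/-- Free variables of a Dependence Logic formula. -/
def DLFormula.free : DLFormula Sig → Set ℕ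
  | .rel _ ts => ⋃ i, (ts i).vars
  | .eq t₁ t₂ => t₁.vars ∪ t₂.vars
  | .dep _ _ ts₁ ts₂ => (⋃ i, (ts₁ i).vars) ∪ ⋃ j, (ts₂ j).vars
  | .neg ψ => ψ.free
  | .or ψ θ => ψ.free ∪ θ.free
  | .ex v ψ => ψ.free \ {v}

/-- A formula is first-order if it contains no dependence atoms. -/
def DLFormula.IsFirstOrder : DLFormula Sig → Prop
  | .rel _ _ => True
  | .eq _ _ => True
  | .dep _ _ _ _ => False
  | .neg ψ => ψ.IsFirstOrder
  | .or ψ θ => ψ.IsFirstOrder ∧ θ.IsFirstOrder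
  | .ex _ ψ => ψ.IsFirstOrder

/-- Tarski satisfaction `M ⊨_s ψ` (meaningful for first-order formulas;
dependence atoms are given the trivial interpretation). -/
def Tarski (M : Model Sig) (s : ℕ → M.Dom) : DLFormula Sig → Prop
  | .rel R ts => M.relInterp R (fun i => (ts i).eval M s)
  | .eq t₁ t₂ => t₁.eval M s = t₂.eval M s
  | .dep _ _ _ _ => True
  | .neg ψ => ¬ Tarski M s ψ
  | .or ψ θ => Tarski M s ψ ∨ Tarski M s θ
  | .ex v ψ => ∃ m : M.Dom, Tarski M (Function.update s v m) ψ

/-- The team `X[F/v] = {s[m/v] : s ∈ X, m ∈ F(s)}`. -/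
def teamSup {M : Model Sig} (X : Set (ℕ → M.Dom)) (v : ℕ)
    (F : (ℕ → M.Dom) → Set M.Dom) : Set (ℕ → M.Dom) :=
  {s' | ∃ s ∈ X, ∃ m ∈ F s, s' = Function.update s v m}

/-- The team `X[M/v] = {s[m/v] : s ∈ X, m ∈ Dom(M)}`. -/
def teamSupAll {M : Model Sig} (X : Set (ℕ → M.Dom)) (v : ℕ) : Set (ℕ → M.Dom) :=
  {s' | ∃ s ∈ X, ∃ m : M.Dom, s' = Function.update s v m}

/-- Team Semantics: `TeamSat M true X ψ` is `(M,X) ⊨⁺ ψ` and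
`TeamSat M false X ψ` is `(M,X) ⊨⁻ ψ`. -/
def TeamSat (M : Model Sig) : Bool → Set (ℕ → M.Dom) → DLFormula Sig → Prop
  | true, X, .rel R ts => ∀ s ∈ X, M.relInterp R (fun i => (ts i).eval M s)
  | false, X, .rel R ts => ∀ s ∈ X, ¬ M.relInterp R (fun i => (ts i).eval M s)
  | true, X, .eq t₁ t₂ => ∀ s ∈ X, t₁.eval M s = t₂.eval M s
  | false, X, .eq t₁ t₂ => ∀ s ∈ X, t₁.eval M s ≠ t₂.eval M s
  | true, X, .dep _ _ ts₁ ts₂ => ∀ s ∈ X, ∀ s' ∈ X,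
      (∀ i, (ts₁ i).eval M s = (ts₁ i).eval M s') →
        ∀ j, (ts₂ j).eval M s = (ts₂ j).eval M s'
  | false, X, .dep _ _ _ _ => X = ∅
  | d, X, .neg ψ => TeamSat M (!d) X ψ
  | true, X, .or ψ θ => ∃ Y Z, X = Y ∪ Z ∧ TeamSat M true Y ψ ∧ TeamSat M true Z θ
  | false, X, .or ψ θ => TeamSat M false X ψ ∧ TeamSat M false X θ
  | true, X, .ex v ψ => ∃ F : (ℕ → M.Dom) → Set M.Dom,
      (∀ s ∈ X, (F s).Nonempty) ∧ TeamSat M true (teamSup X v F) ψ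
  | false, X, .ex v ψ => TeamSat M false (teamSupAll X v) ψ

/-- A fixed (arbitrary) assignment, playing the role of the empty assignment. -/
noncomputable def Model.defAsg (M : Model Sig) : ℕ → M.Dom :=
  fun _ => Classical.choice M.nonempty

/-- Truth/falsity of a sentence: `M ⊨ᵈ φ` iff `(M, {∅}) ⊨ᵈ φ`. -/
def Model.sat (M : Model Sig) (d : Bool) (φ : DLFormula Sig) : Prop :=
  TeamSat M d {M.defAsg} φ

/-- Paraconsistent Team Semantics: `(M,X) ⊨ₚᵈ ψ` iff `(M,X) ⊭^{d*} ψ`. -/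
def PTeamSat (M : Model Sig) (d : Bool) (X : Set (ℕ → M.Dom))
    (ψ : DLFormula Sig) : Prop :=
  ¬ TeamSat M (!d) X ψ

/-- Paraconsistent truth/falsity of a sentence. -/
def Model.psat (M : Model Sig) (d : Bool) (φ : DLFormula Sig) : Prop :=
  PTeamSat M d {M.defAsg} φ

/-- Extension of a signature with `k` new relation symbols of arities `ar`. -/
def Signature.addRels (Sig : Signature) (k : ℕ) (ar : Fin k → ℕ) : Signature where
  Rel := Sig.Rel ⊕ Fin k
  relArity := Sum.elim Sig.relArity ar
  Func := Sig.Func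
  funcArity := Sig.funcArity

/-- Expansion of a model with interpretations `S` for the new relation symbols. -/
def Model.addRels (M : Model Sig) (k : ℕ) (ar : Fin k → ℕ)
    (S : ∀ i : Fin k, (Fin (ar i) → M.Dom) → Prop) : Model (Sig.addRels k ar) where
  Dom := M.Dom
  nonempty := M.nonempty
  relInterp := fun R => match R with
    | .inl r => M.relInterp r
    | .inr i => S i
  funcInterp := M.funcInterp


/-! ## Terms and formulas -/

/-- All variables occurring in a formula, free or bound. -/
def DLFormula.vars : DLFormula Sig → Set ℕ
  | .rel _ ts => ⋃ i, (ts i).vars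
  | .eq t₁ t₂ => t₁.vars ∪ t₂.vars
  | .dep _ _ ts₁ ts₂ => (⋃ i, (ts₁ i).vars) ∪ ⋃ j, (ts₂ j).vars
  | .neg ψ => ψ.vars
  | .or ψ θ => ψ.vars ∪ θ.vars
  | .ex v ψ => insert v ψ.vars

theorem Term.finite_vars (t : Term Sig) : t.vars.Finite := by
  induction t with
  | var v => exact Set.finite_singleton v
  | func f ts ih => exact Set.finite_iUnion ih

theorem DLFormula.finite_vars (ψ : DLFormula Sig) : ψ.vars.Finite := by
  induction ψ with
  | rel R ts => exact Set.finite_iUnion fun i => (ts i).finite_vars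
  | eq t₁ t₂ => exact t₁.finite_vars.union t₂.finite_vars
  | dep n m ts₁ ts₂ =>
    exact (Set.finite_iUnion fun i => (ts₁ i).finite_vars).union
      (Set.finite_iUnion fun i => (ts₂ i).finite_vars)
  | neg ψ ih => exact ih
  | or ψ θ ih₁ ih₂ => exact ih₁.union ih₂
  | ex v ψ ih => exact ih.insert v

theorem DLFormula.free_subset_vars (ψ : DLFormula Sig) : ψ.free ⊆ ψ.vars := by
  induction ψ with
  | rel R ts => exact subset_rfl
  | eq t₁ t₂ => exact subset_rfl
  | dep n m ts₁ ts₂ => exact subset_rfl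
  | neg ψ ih => exact ih
  | or ψ θ ih₁ ih₂ => exact Set.union_subset_union ih₁ ih₂
  | ex v ψ ih => exact fun x hx => Set.mem_insert_of_mem _ (ih hx.1)

theorem DLFormula.exists_vars_subset_Iio (ψ : DLFormula Sig) : ∃ N, ψ.vars ⊆ Set.Iio N := by
  obtain ⟨N, hN⟩ := ψ.finite_vars.bddAbove
  exact ⟨N + 1, fun x hx => Nat.lt_succ_of_le (hN hx)⟩

/-- A valid formula. -/
def DLFormula.top : DLFormula Sig := .eq (.var 0) (.var 0)

/-- Universal quantification over a list of variables. -/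
def DLFormula.alls (l : List ℕ) (ψ : DLFormula Sig) : DLFormula Sig := l.foldr .all ψ

/-- Existential quantification over a list of variables. -/
def DLFormula.exs (l : List ℕ) (ψ : DLFormula Sig) : DLFormula Sig := l.foldr .ex ψ

/-- Conjunction of a list of formulas. -/
def DLFormula.bigConj (l : List (DLFormula Sig)) : DLFormula Sig := l.foldr .conj .top

/-- The formula itself or its negation. -/
def DLFormula.lit : Bool → DLFormula Sig → DLFormula Sig
  | true, ψ => ψ
  | false, ψ => ψ.neg

theorem DLFormula.free_alls (l : List ℕ) (ψ : DLFormula Sig) :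
    (ψ.alls l).free = ψ.free \ {x | x ∈ l} := by
  induction l with
  | nil => simp [alls]
  | cons a l ih =>
    change (ψ.alls l).free \ {a} = _
    rw [ih]; ext x; simp; tauto

theorem DLFormula.exists_free_alls_eq_empty (ψ : DLFormula Sig) :
    ∃ l, (ψ.alls l).free = ∅ := by
  obtain ⟨N, hN⟩ := ψ.exists_vars_subset_Iio
  refine ⟨List.range N, ?_⟩
  rw [free_alls, Set.sdiff_eq_empty]
  intro x hx
  simpa using hN (ψ.free_subset_vars hx)

theorem DLFormula.isFirstOrder_alls (l : List ℕ) (ψ : DLFormula Sig) :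
    (ψ.alls l).IsFirstOrder ↔ ψ.IsFirstOrder := by
  induction l with
  | nil => rfl
  | cons a l ih => exact ih

theorem DLFormula.isFirstOrder_conj (ψ θ : DLFormula Sig) :
    (ψ.conj θ).IsFirstOrder ↔ ψ.IsFirstOrder ∧ θ.IsFirstOrder := Iff.rfl

theorem DLFormula.isFirstOrder_bigConj (l : List (DLFormula Sig)) :
    (bigConj l).IsFirstOrder ↔ ∀ ψ ∈ l, ψ.IsFirstOrder := by
  induction l with
  | nil => simp [bigConj, top, IsFirstOrder]
  | cons a l ih =>
    rw [List.forall_mem_cons, ← ih]; rfl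

theorem DLFormula.isFirstOrder_lit (d : Bool) (ψ : DLFormula Sig) :
    (lit d ψ).IsFirstOrder ↔ ψ.IsFirstOrder := by cases d <;> rfl

/-! ## Tarski semantics -/

theorem Term.eval_congr {M : Model Sig} {s s' : ℕ → M.Dom} (t : Term Sig)
    (h : Set.EqOn s s' t.vars) : t.eval M s = t.eval M s' := by
  induction t with
  | var v => exact h rfl
  | func f ts ih =>
    simp only [Term.eval]
    congr 1; ext i
    exact ih i fun x hx => h (Set.mem_iUnion_of_mem i hx)

theorem Set.EqOn.update_insert {α : Type*} {V : Set ℕ} {s s' : ℕ → α} (h : Set.EqOn s s' V)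
    (v : ℕ) (m : α) :
    Set.EqOn (Function.update s v m) (Function.update s' v m) (insert v V) := by
  intro x hx
  by_cases hxv : x = v
  · simp [hxv]
  · simpa [hxv] using h (hx.resolve_left hxv)

theorem Tarski_congr {M : Model Sig} (ψ : DLFormula Sig) {s s' : ℕ → M.Dom}
    (h : Set.EqOn s s' ψ.free) : Tarski M s ψ ↔ Tarski M s' ψ := by
  induction ψ generalizing s s' with
  | rel R ts =>
    simp only [Tarski]
    rw [funext fun i => (ts i).eval_congr fun x hx => h (Set.mem_iUnion_of_mem i hx)]
  | eq t₁ t₂ =>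
    simp only [Tarski]
    rw [t₁.eval_congr fun x hx => h (.inl hx), t₂.eval_congr fun x hx => h (.inr hx)]
  | dep n m ts₁ ts₂ => simp [Tarski]
  | neg ψ ih => simp only [Tarski]; rw [ih h]
  | or ψ θ ih₁ ih₂ =>
    simp only [Tarski]
    rw [ih₁ fun x hx => h (.inl hx), ih₂ fun x hx => h (.inr hx)]
  | ex v ψ ih =>
    simp only [Tarski]
    refine exists_congr fun m => ih ((h.update_insert v m).mono fun x hx => ?_)
    by_cases hxv : x = v
    · exact .inl hxv
    · exact .inr ⟨hx, hxv⟩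

theorem Tarski_conj {M : Model Sig} {s : ℕ → M.Dom} {ψ θ : DLFormula Sig} :
    Tarski M s (ψ.conj θ) ↔ Tarski M s ψ ∧ Tarski M s θ := by
  simp [DLFormula.conj, Tarski]

theorem Tarski_all {M : Model Sig} {s : ℕ → M.Dom} {v : ℕ} {ψ : DLFormula Sig} :
    Tarski M s (ψ.all v) ↔ ∀ m, Tarski M (Function.update s v m) ψ := by
  simp [DLFormula.all, Tarski]

theorem Tarski_bigConj {M : Model Sig} {s : ℕ → M.Dom} {l : List (DLFormula Sig)} :
    Tarski M s (.bigConj l) ↔ ∀ ψ ∈ l, Tarski M s ψ := by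
  induction l with
  | nil => simp [DLFormula.bigConj, DLFormula.top, Tarski]
  | cons a l ih => rw [List.forall_mem_cons, ← ih]; exact Tarski_conj

theorem Tarski_lit {M : Model Sig} {s : ℕ → M.Dom} {d : Bool} {ψ : DLFormula Sig} :
    Tarski M s (.lit d ψ) ↔ (Tarski M s ψ ↔ d = true) := by
  cases d <;> simp [DLFormula.lit, Tarski]

/-- Two assignments agree on all variables outside a list. -/
def EqOff {α : Type*} (l : List ℕ) (s s' : ℕ → α) : Prop := ∀ i ∉ l, s i = s' i

theorem eqOff_cons {α : Type*} {a : ℕ} {l : List ℕ} {s s' : ℕ → α} :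
    EqOff (a :: l) s s' ↔ ∃ m, EqOff l (Function.update s a m) s' := by
  constructor
  · intro h
    refine ⟨s' a, fun i hi => ?_⟩
    by_cases hia : i = a
    · simp [hia]
    · simpa [hia] using h i (by simp [hia, hi])
  · rintro ⟨m, h⟩ i hi
    rw [List.mem_cons, not_or] at hi
    simpa [hi.1] using h i hi.2

theorem eqOff_refl {α : Type*} (l : List ℕ) (s : ℕ → α) : EqOff l s s := fun _ _ => rfl

theorem Tarski_alls {M : Model Sig} {l : List ℕ} {s : ℕ → M.Dom} {ψ : DLFormula Sig} :
    Tarski M s (ψ.alls l) ↔ ∀ s', EqOff l s s' → Tarski M s' ψ := by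
  induction l generalizing s with
  | nil =>
    exact ⟨fun h s' hs => (funext fun i => hs i List.not_mem_nil : s = s') ▸ h,
      fun h => h s (eqOff_refl _ _)⟩
  | cons a l ih =>
    change Tarski M s ((ψ.alls l).all a) ↔ _
    rw [Tarski_all]
    simp only [ih, eqOff_cons]
    exact ⟨fun h s' ⟨m, hm⟩ => h m s' hm, fun h m s' hm => h s' ⟨m, hm⟩⟩

theorem Tarski_alls_iff_forall {M : Model Sig} {l : List ℕ} {ψ : DLFormula Sig}
    (hl : (ψ.alls l).free = ∅) (s : ℕ → M.Dom) :
    Tarski M s (ψ.alls l) ↔ ∀ s', Tarski M s' ψ := by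
  refine ⟨fun h s' => ?_, fun h => Tarski_alls.2 fun s' _ => h s'⟩
  rw [Tarski_congr (s' := s') _ (by simp [hl])] at h
  exact Tarski_alls.1 h s' (eqOff_refl _ _)

/-! ## Team semantics -/

section Team

variable {M : Model Sig} {X : Set (ℕ → M.Dom)} {ψ θ : DLFormula Sig}

theorem TeamSat_neg {d : Bool} : TeamSat M d X ψ.neg ↔ TeamSat M (!d) X ψ := by
  cases d <;> simp [TeamSat]

theorem TeamSat_conj :
    TeamSat M true X (ψ.conj θ) ↔ TeamSat M true X ψ ∧ TeamSat M true X θ := by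
  simp [DLFormula.conj, TeamSat]

theorem TeamSat_all {v : ℕ} :
    TeamSat M true X (ψ.all v) ↔ TeamSat M true (teamSupAll X v) ψ := by
  simp [DLFormula.all, TeamSat]

theorem TeamSat_bigConj {l : List (DLFormula Sig)} :
    TeamSat M true X (.bigConj l) ↔ ∀ ψ ∈ l, TeamSat M true X ψ := by
  induction l with
  | nil => simp [DLFormula.bigConj, DLFormula.top, TeamSat]
  | cons a l ih => rw [List.forall_mem_cons, ← ih]; exact TeamSat_conj

/-- The team `X'` arises from `X` by reassigning the variable `v`. -/
def IsSupplement (X X' : Set (ℕ → M.Dom)) (v : ℕ) : Prop :=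
  (∀ s ∈ X, ∃ m, Function.update s v m ∈ X') ∧
    ∀ s' ∈ X', ∃ s ∈ X, ∃ m, s' = Function.update s v m

theorem TeamSat_ex {v : ℕ} :
    TeamSat M true X (.ex v ψ) ↔ ∃ X', IsSupplement X X' v ∧ TeamSat M true X' ψ := by
  simp only [TeamSat]
  constructor
  · rintro ⟨F, hF, h⟩
    refine ⟨_, ⟨fun s hs => ?_, ?_⟩, h⟩
    · obtain ⟨m, hm⟩ := hF s hs
      exact ⟨m, s, hs, m, hm, rfl⟩
    · rintro s' ⟨s, hs, m, -, rfl⟩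
      exact ⟨s, hs, m, rfl⟩
  · rintro ⟨X', ⟨h₁, h₂⟩, h⟩
    refine ⟨fun s => {m | Function.update s v m ∈ X'}, h₁, ?_⟩
    convert h
    ext s'
    constructor
    · rintro ⟨s, hs, m, hm, rfl⟩
      exact hm
    · intro hs'
      obtain ⟨s, hs, m, rfl⟩ := h₂ s' hs'
      exact ⟨s, hs, m, hs', rfl⟩

theorem TeamSat_empty (d : Bool) : TeamSat M d ∅ ψ := by
  induction ψ generalizing d with
  | neg ψ ih => exact TeamSat_neg.2 (ih _)
  | or ψ θ ih₁ ih₂ =>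
    cases d
    · exact ⟨ih₁ _, ih₂ _⟩
    · exact ⟨∅, ∅, by simp, ih₁ _, ih₂ _⟩
  | ex v ψ ih =>
    cases d
    · have : teamSupAll (∅ : Set (ℕ → M.Dom)) v = ∅ := by simp [teamSupAll]
      simpa [TeamSat, this] using ih _
    · exact TeamSat_ex.2 ⟨∅, by simp [IsSupplement], ih _⟩
  | _ => cases d <;> simp [TeamSat]

theorem TeamSat_iff_forall_Tarski (hψ : ψ.IsFirstOrder) (d : Bool) :
    TeamSat M d X ψ ↔ ∀ s ∈ X, (Tarski M s ψ ↔ d = true) := by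
  induction ψ generalizing d X with
  | rel R ts => cases d <;> simp [TeamSat, Tarski]
  | eq t₁ t₂ => cases d <;> simp [TeamSat, Tarski]
  | dep n m ts₁ ts₂ => exact hψ.elim
  | neg ψ ih => rw [TeamSat_neg, ih hψ]; cases d <;> simp [Tarski]
  | or ψ θ ih₁ ih₂ =>
    cases d
    · simp only [TeamSat, ih₁ hψ.1, ih₂ hψ.2, Tarski]
      simp [forall_and]
    · simp only [TeamSat, ih₁ hψ.1, ih₂ hψ.2, Tarski, iff_true]
      constructor
      · rintro ⟨Y, Z, rfl, hY, hZ⟩ s (hs | hs)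
        exacts [.inl (hY s hs), .inr (hZ s hs)]
      · intro h
        refine ⟨{s ∈ X | Tarski M s ψ}, {s ∈ X | Tarski M s θ}, ?_, fun s hs => hs.2,
          fun s hs => hs.2⟩
        ext s
        exact ⟨fun hs => (h s hs).imp (⟨hs, ·⟩) (⟨hs, ·⟩), fun hs => hs.elim (·.1) (·.1)⟩
  | ex v ψ ih =>
    cases d
    · simp only [TeamSat, ih hψ, Tarski, teamSupAll]
      simp only [Bool.false_eq_true, iff_false, not_exists]
      exact ⟨fun h s hs m => h _ ⟨s, hs, m, rfl⟩, by rintro h _ ⟨s, hs, m, rfl⟩; exact h s hs m⟩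
    · simp only [TeamSat_ex, ih hψ, Tarski, iff_true]
      constructor
      · rintro ⟨X', ⟨h₁, -⟩, h⟩ s hs
        obtain ⟨m, hm⟩ := h₁ s hs
        exact ⟨m, h _ hm⟩
      · intro h
        refine ⟨{s' | (∃ s ∈ X, ∃ m, s' = Function.update s v m) ∧ Tarski M s' ψ},
          ⟨fun s hs => ?_, fun s hs => hs.1⟩, fun s hs => hs.2⟩
        obtain ⟨m, hm⟩ := h s hs
        exact ⟨m, ⟨s, hs, m, rfl⟩, hm⟩

/-- Two teams have the same restriction to `V`. -/
def SameOn (V : Set ℕ) (X Y : Set (ℕ → M.Dom)) : Prop :=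
  (∀ s ∈ X, ∃ s' ∈ Y, Set.EqOn s s' V) ∧ ∀ s' ∈ Y, ∃ s ∈ X, Set.EqOn s s' V

theorem SameOn.left_subteam {V : Set ℕ} {X Y X' : Set (ℕ → M.Dom)} (h : SameOn V X Y)
    (hX : X' ⊆ X) : SameOn V X' {s' ∈ Y | ∃ s ∈ X', Set.EqOn s s' V} := by
  refine ⟨fun s hs => ?_, fun s' hs' => hs'.2⟩
  obtain ⟨s', hs', e⟩ := h.1 s (hX hs)
  exact ⟨s', ⟨hs', s, hs, e⟩, e⟩

theorem TeamSat.congr {V : Set ℕ} {Y : Set (ℕ → M.Dom)} {d : Bool} (hV : ψ.free ⊆ V)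
    (h : SameOn V X Y) (hX : TeamSat M d X ψ) : TeamSat M d Y ψ := by
  induction ψ generalizing V X Y d with
  | rel R ts =>
    have hFO : (DLFormula.rel R ts).IsFirstOrder := trivial
    rw [TeamSat_iff_forall_Tarski hFO] at hX ⊢
    intro s' hs'
    obtain ⟨s, hs, e⟩ := h.2 s' hs'
    rw [← Tarski_congr _ (e.mono hV)]
    exact hX s hs
  | eq t₁ t₂ =>
    have hFO : (DLFormula.eq t₁ t₂).IsFirstOrder := trivial
    rw [TeamSat_iff_forall_Tarski hFO] at hX ⊢
    intro s' hs'
    obtain ⟨s, hs, e⟩ := h.2 s' hs'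
    rw [← Tarski_congr _ (e.mono hV)]
    exact hX s hs
  | dep n m ts₁ ts₂ =>
    cases d
    · simp only [TeamSat] at hX ⊢
      subst hX
      exact Set.eq_empty_of_forall_notMem fun s' hs' => by simpa using h.2 s' hs'
    · simp only [TeamSat] at hX ⊢
      intro s' hs' r' hr'
      obtain ⟨s, hs, e⟩ := h.2 s' hs'
      obtain ⟨r, hr, e'⟩ := h.2 r' hr'
      have key₁ : ∀ {s s' : ℕ → M.Dom}, Set.EqOn s s' V → ∀ i,
          (ts₁ i).eval M s = (ts₁ i).eval M s' := fun e i =>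
        (ts₁ i).eval_congr fun x hx => e (hV (.inl (Set.mem_iUnion_of_mem i hx)))
      have key₂ : ∀ {s s' : ℕ → M.Dom}, Set.EqOn s s' V → ∀ i,
          (ts₂ i).eval M s = (ts₂ i).eval M s' := fun e i =>
        (ts₂ i).eval_congr fun x hx => e (hV (.inr (Set.mem_iUnion_of_mem i hx)))
      intro h₁ j
      rw [← key₂ e, ← key₂ e']
      refine hX s hs r hr (fun i => ?_) j
      rw [key₁ e, key₁ e', h₁]
  | neg ψ ih => exact TeamSat_neg.2 (ih hV h (TeamSat_neg.1 hX))
  | or ψ θ ih₁ ih₂ =>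
    have hV₁ : ψ.free ⊆ V := fun x hx => hV (.inl hx)
    have hV₂ : θ.free ⊆ V := fun x hx => hV (.inr hx)
    cases d
    · exact ⟨ih₁ hV₁ h hX.1, ih₂ hV₂ h hX.2⟩
    · obtain ⟨X₁, X₂, rfl, h₁, h₂⟩ := hX
      refine ⟨_, _, ?_, ih₁ hV₁ (h.left_subteam Set.subset_union_left) h₁,
        ih₂ hV₂ (h.left_subteam Set.subset_union_right) h₂⟩
      ext s'
      constructor
      · intro hs'
        obtain ⟨s, hs | hs, e⟩ := h.2 s' hs'
        exacts [.inl ⟨hs', s, hs, e⟩, .inr ⟨hs', s, hs, e⟩]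
      · rintro (hs' | hs') <;> exact hs'.1
  | ex v ψ ih =>
    have hV' : ψ.free ⊆ insert v V := fun x hx => by
      by_cases hxv : x = v
      · exact .inl hxv
      · exact .inr (hV ⟨hx, hxv⟩)
    cases d
    · refine ih hV' ⟨?_, ?_⟩ (X := teamSupAll X v) hX
      · rintro _ ⟨s, hs, m, rfl⟩
        obtain ⟨s', hs', e⟩ := h.1 s hs
        exact ⟨_, ⟨s', hs', m, rfl⟩, e.update_insert v m⟩
      · rintro _ ⟨s', hs', m, rfl⟩
        obtain ⟨s, hs, e⟩ := h.2 s' hs'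
        exact ⟨_, ⟨s, hs, m, rfl⟩, e.update_insert v m⟩
    · obtain ⟨X', ⟨h₁, h₂⟩, hX'⟩ := TeamSat_ex.1 hX
      refine TeamSat_ex.2 ⟨{r' | ∃ s' ∈ Y, ∃ s ∈ X, ∃ m, Set.EqOn s s' V ∧
        Function.update s v m ∈ X' ∧ r' = Function.update s' v m}, ⟨?_, ?_⟩,
        ih hV' ⟨?_, ?_⟩ hX'⟩
      · intro s' hs'
        obtain ⟨s, hs, e⟩ := h.2 s' hs'
        obtain ⟨m, hm⟩ := h₁ s hs
        exact ⟨m, s', hs', s, hs, m, e, hm, rfl⟩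
      · rintro _ ⟨s', hs', s, hs, m, e, hm, rfl⟩
        exact ⟨s', hs', m, rfl⟩
      · intro r hr
        obtain ⟨s, hs, m, rfl⟩ := h₂ r hr
        obtain ⟨s', hs', e⟩ := h.1 s hs
        exact ⟨_, ⟨s', hs', s, hs, m, e, hr, rfl⟩, e.update_insert v m⟩
      · rintro _ ⟨s', hs', s, hs, m, e, hm, rfl⟩
        exact ⟨_, hm, e.update_insert v m⟩

theorem TeamSat_alls {l : List ℕ} :
    TeamSat M true X (ψ.alls l) ↔ TeamSat M true {s' | ∃ s ∈ X, EqOff l s s'} ψ := by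
  induction l generalizing X with
  | nil =>
    have : {s' | ∃ s ∈ X, EqOff [] s s'} = X := by
      ext s'
      refine ⟨?_, fun h => ⟨s', h, eqOff_refl _ _⟩⟩
      rintro ⟨s, hs, e⟩
      exact (funext fun i => e i List.not_mem_nil : s = s') ▸ hs
    rw [this]; rfl
  | cons a l ih =>
    change TeamSat M true X ((ψ.alls l).all a) ↔ _
    rw [TeamSat_all, ih]
    refine iff_of_eq (congrArg (TeamSat M true · ψ) ?_)
    ext s'
    simp only [teamSupAll, Set.mem_ofPred_eq, eqOff_cons]
    exact ⟨fun ⟨_, ⟨s, hs, m, e⟩, h⟩ => ⟨s, hs, m, e ▸ h⟩,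
      fun ⟨s, hs, m, h⟩ => ⟨_, ⟨s, hs, m, rfl⟩, h⟩⟩

theorem TeamSat_exs {l : List ℕ} :
    TeamSat M true X (ψ.exs l) ↔ ∃ X', (∀ s ∈ X, ∃ s' ∈ X', EqOff l s s') ∧
      (∀ s' ∈ X', ∃ s ∈ X, EqOff l s s') ∧ TeamSat M true X' ψ := by
  induction l generalizing X with
  | nil =>
    have key : ∀ {s s' : ℕ → M.Dom}, EqOff [] s s' ↔ s = s' :=
      ⟨fun e => funext fun i => e i List.not_mem_nil, fun e => e ▸ eqOff_refl _ _⟩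
    simp only [key]
    refine ⟨fun h => ⟨X, fun s hs => ⟨s, hs, rfl⟩, fun s hs => ⟨s, hs, rfl⟩, h⟩, ?_⟩
    rintro ⟨X', h₁, h₂, h⟩
    have : X = X' := by
      ext s
      constructor
      · intro hs
        obtain ⟨_, hs', rfl⟩ := h₁ s hs
        exact hs'
      · intro hs
        obtain ⟨_, hs', rfl⟩ := h₂ s hs
        exact hs'
    rwa [this]
  | cons a l ih =>
    change TeamSat M true X ((ψ.exs l).ex a) ↔ _
    simp only [TeamSat_ex, ih, eqOff_cons]
    constructor
    · rintro ⟨X₁, ⟨a₁, a₂⟩, X', b₁, b₂, h⟩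
      refine ⟨X', fun s hs => ?_, fun s' hs' => ?_, h⟩
      · obtain ⟨m, hm⟩ := a₁ s hs
        obtain ⟨s', hs', e⟩ := b₁ _ hm
        exact ⟨s', hs', m, e⟩
      · obtain ⟨s₁, hs₁, e⟩ := b₂ s' hs'
        obtain ⟨s, hs, m, rfl⟩ := a₂ s₁ hs₁
        exact ⟨s, hs, m, e⟩
    · rintro ⟨X', h₁, h₂, h⟩
      refine ⟨{r | ∃ s ∈ X, ∃ m, r = Function.update s a m ∧ ∃ s' ∈ X', EqOff l r s'},
        ⟨fun s hs => ?_, ?_⟩, X', ?_, fun s' hs' => ?_, h⟩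
      · obtain ⟨s', hs', m, e⟩ := h₁ s hs
        exact ⟨m, s, hs, m, rfl, s', hs', e⟩
      · rintro r ⟨s, hs, m, e, -⟩
        exact ⟨s, hs, m, e⟩
      · rintro r ⟨s, hs, m, -, h⟩
        exact h
      · obtain ⟨s, hs, m, e⟩ := h₂ s' hs'
        exact ⟨_, ⟨s, hs, m, rfl, s', hs', e⟩, e⟩

end Team

/-! ## Expansions by relation symbols -/

section Expansion

variable {k : ℕ} {ar : Fin k → ℕ}

/-- Regard a term as a term of an expanded signature, shifting its variables by `n`. -/
def Term.lift (k : ℕ) (ar : Fin k → ℕ) (n : ℕ) : Term Sig → Term (Sig.addRels k ar)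
  | .var v => .var (v + n)
  | .func f ts => .func (Sig := Sig.addRels k ar) f fun i => (ts i).lift k ar n

/-- Regard a term of a signature expanded by relation symbols as a term of the signature. -/
def Term.lower : Term (Sig.addRels k ar) → Term Sig
  | .var v => .var v
  | .func f ts => .func (Sig := Sig) f fun i => (ts i).lower

/-- Satisfaction of a formula in the expansion of a model by relations. -/
def TarskiExp (M : Model Sig) (S : ∀ i : Fin k, (Fin (ar i) → M.Dom) → Prop) (s : ℕ → M.Dom)
    (ψ : DLFormula (Sig.addRels k ar)) : Prop :=
  Tarski (M.addRels k ar S) s ψ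

variable {M : Model Sig} {S : ∀ i : Fin k, (Fin (ar i) → M.Dom) → Prop} {s : ℕ → M.Dom}

theorem Term.eval_lift (t : Term Sig) (n : ℕ) :
    (t.lift k ar n).eval (M.addRels k ar S) s = t.eval M fun i => s (i + n) := by
  induction t with
  | var v => rfl
  | func f ts ih => exact congrArg (M.funcInterp f) (funext ih)

theorem Term.eval_lower (t : Term (Sig.addRels k ar)) :
    t.lower.eval M s = t.eval (M.addRels k ar S) s := by
  induction t with
  | var v => rfl
  | func f ts ih => exact congrArg (M.funcInterp f) (funext ih)

theorem Term.vars_lower (t : Term (Sig.addRels k ar)) : t.lower.vars = t.vars := by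
  induction t with
  | var v => rfl
  | func f ts ih => exact Set.iUnion_congr ih

theorem TarskiExp_eq {t₁ t₂ : Term (Sig.addRels k ar)} :
    TarskiExp M S s (.eq t₁ t₂) ↔
      t₁.eval (M.addRels k ar S) s = t₂.eval (M.addRels k ar S) s := Iff.rfl

theorem TarskiExp_neg {ψ : DLFormula (Sig.addRels k ar)} :
    TarskiExp M S s ψ.neg ↔ ¬ TarskiExp M S s ψ := Iff.rfl

theorem TarskiExp_or {ψ θ : DLFormula (Sig.addRels k ar)} :
    TarskiExp M S s (ψ.or θ) ↔ TarskiExp M S s ψ ∨ TarskiExp M S s θ := Iff.rfl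

theorem TarskiExp_ex {v : ℕ} {ψ : DLFormula (Sig.addRels k ar)} :
    TarskiExp M S s (.ex v ψ) ↔ ∃ m, TarskiExp M S (Function.update s v m) ψ := Iff.rfl

theorem TarskiExp_conj {ψ θ : DLFormula (Sig.addRels k ar)} :
    TarskiExp M S s (ψ.conj θ) ↔ TarskiExp M S s ψ ∧ TarskiExp M S s θ := Tarski_conj

theorem TarskiExp_lit {d : Bool} {ψ : DLFormula (Sig.addRels k ar)} :
    TarskiExp M S s (.lit d ψ) ↔ (TarskiExp M S s ψ ↔ d = true) := Tarski_lit

theorem TarskiExp_bigConj {l : List (DLFormula (Sig.addRels k ar))} :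
    TarskiExp M S s (.bigConj l) ↔ ∀ ψ ∈ l, TarskiExp M S s ψ := Tarski_bigConj

theorem TarskiExp_congr (ψ : DLFormula (Sig.addRels k ar)) {s' : ℕ → M.Dom}
    (h : Set.EqOn s s' ψ.free) : TarskiExp M S s ψ ↔ TarskiExp M S s' ψ := Tarski_congr ψ h

end Expansion

/-! ## From Dependence Logic to existential second-order logic -/

namespace DLFormula

/-- Implication. -/
def imp (ψ θ : DLFormula Sig) : DLFormula Sig := ψ.neg.or θ

/-- Equivalence. -/
def biimp (ψ θ : DLFormula Sig) : DLFormula Sig := (ψ.imp θ).conj (θ.imp ψ)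

/-- Indices for the teams occurring in an evaluation of a formula. -/
def TeamIdx : DLFormula Sig → Type
  | .neg ψ => ψ.TeamIdx
  | .or ψ θ => Option (ψ.TeamIdx ⊕ θ.TeamIdx)
  | .ex _ ψ => Option ψ.TeamIdx
  | _ => Unit

/-- The index of the team at which the formula itself is evaluated. -/
def root : (ψ : DLFormula Sig) → ψ.TeamIdx
  | .rel _ _ => ()
  | .eq _ _ => ()
  | .dep _ _ _ _ => ()
  | .neg ψ => ψ.root
  | .or _ _ => none
  | .ex _ _ => none

theorem finite_teamIdx (ψ : DLFormula Sig) : Finite ψ.TeamIdx := by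
  induction ψ with
  | neg ψ ih => exact ih
  | or ψ θ ih₁ ih₂ => exact inferInstanceAs (Finite (Option (ψ.TeamIdx ⊕ θ.TeamIdx)))
  | ex v ψ ih => exact inferInstanceAs (Finite (Option ψ.TeamIdx))
  | _ => exact inferInstanceAs (Finite Unit)

end DLFormula

/-- The team of all assignments whose restriction to the first `N` variables satisfies `T`. -/
def cylinder {α : Type} {N : ℕ} (T : (Fin N → α) → Prop) : Set (ℕ → α) :=
  {s | T fun i => s i}

/-- The teams `S` (given as relations) witness the evaluation of a formula. -/
def TeamCert (M : Model Sig) (N : ℕ) : (ψ : DLFormula Sig) → Bool →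
    (ψ.TeamIdx → (Fin N → M.Dom) → Prop) → Prop
  | .rel R ts, d, S => TeamSat M d (cylinder (S ())) (.rel R ts)
  | .eq t₁ t₂, d, S => TeamSat M d (cylinder (S ())) (.eq t₁ t₂)
  | .dep n m ts₁ ts₂, d, S => TeamSat M d (cylinder (S ())) (.dep n m ts₁ ts₂)
  | .neg ψ, d, S => TeamCert M N ψ (!d) S
  | .or ψ θ, true, S =>
    cylinder (S none) = cylinder (S (some (.inl ψ.root))) ∪ cylinder (S (some (.inr θ.root))) ∧
      TeamCert M N ψ true (fun i => S (some (.inl i))) ∧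
      TeamCert M N θ true (fun i => S (some (.inr i)))
  | .or ψ θ, false, S =>
    (cylinder (S (some (.inl ψ.root))) = cylinder (S none) ∧
      cylinder (S (some (.inr θ.root))) = cylinder (S none)) ∧
      TeamCert M N ψ false (fun i => S (some (.inl i))) ∧
      TeamCert M N θ false (fun i => S (some (.inr i)))
  | .ex v ψ, true, S =>
    IsSupplement (cylinder (S none)) (cylinder (S (some ψ.root))) v ∧
      TeamCert M N ψ true (fun i => S (some i))
  | .ex v ψ, false, S =>
    cylinder (S (some ψ.root)) = teamSupAll (cylinder (S none)) v ∧
      TeamCert M N ψ false (fun i => S (some i))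

section Cylinder

variable {M : Model Sig} {N : ℕ} {X : Set (ℕ → M.Dom)}

/-- The restriction of a team to the first `N` variables, as a relation. -/
def restrictTeam (N : ℕ) (X : Set (ℕ → M.Dom)) : (Fin N → M.Dom) → Prop :=
  fun t => ∃ s ∈ X, (fun i : Fin N => s i) = t

theorem mem_cylinder_restrictTeam {s' : ℕ → M.Dom} :
    s' ∈ cylinder (restrictTeam N X) ↔ ∃ s ∈ X, Set.EqOn s s' (Set.Iio N) :=
  exists_congr fun _ => and_congr_right fun _ =>
    ⟨fun h i hi => congrFun h ⟨i, hi⟩, fun h => funext fun i => h i.2⟩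

theorem mem_cylinder_congr {T : (Fin N → M.Dom) → Prop} {s s' : ℕ → M.Dom}
    (h : Set.EqOn s s' (Set.Iio N)) : s ∈ cylinder T ↔ s' ∈ cylinder T := by
  have : (fun i : Fin N => s i) = fun i : Fin N => s' i := funext fun i => h i.2
  change T _ ↔ T _
  rw [this]

theorem sameOn_cylinder_restrictTeam : SameOn (Set.Iio N) X (cylinder (restrictTeam N X)) :=
  ⟨fun s hs => ⟨s, mem_cylinder_restrictTeam.2 ⟨s, hs, fun _ _ => rfl⟩, fun _ _ => rfl⟩,
    fun _ hs' => mem_cylinder_restrictTeam.1 hs'⟩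

theorem exists_cylinder_eq (h : ∀ s s', Set.EqOn s s' (Set.Iio N) → s ∈ X → s' ∈ X) :
    cylinder (restrictTeam N X) = X := by
  ext s'
  rw [mem_cylinder_restrictTeam]
  exact ⟨fun ⟨s, hs, e⟩ => h s s' e hs, fun hs' => ⟨s', hs', fun _ _ => rfl⟩⟩

theorem TeamSat.cylinder_restrictTeam {ψ : DLFormula Sig} {d : Bool} (hψ : ψ.vars ⊆ Set.Iio N)
    (h : TeamSat M d X ψ) : TeamSat M d (cylinder (restrictTeam N X)) ψ :=
  h.congr (ψ.free_subset_vars.trans hψ) sameOn_cylinder_restrictTeam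

theorem TeamSat_cylinder_iff {ψ : DLFormula Sig} (hψ : ψ.vars ⊆ Set.Iio N) (d : Bool)
    (T : (Fin N → M.Dom) → Prop) :
    TeamSat M d (cylinder T) ψ ↔ ∃ S, S ψ.root = T ∧ TeamCert M N ψ d S := by
  induction ψ generalizing d T with
  | rel R ts => exact ⟨fun h => ⟨fun _ => T, rfl, h⟩, by rintro ⟨S, rfl, h⟩; exact h⟩
  | eq t₁ t₂ => exact ⟨fun h => ⟨fun _ => T, rfl, h⟩, by rintro ⟨S, rfl, h⟩; exact h⟩
  | dep n m ts₁ ts₂ => exact ⟨fun h => ⟨fun _ => T, rfl, h⟩, by rintro ⟨S, rfl, h⟩; exact h⟩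
  | neg ψ ih => rw [TeamSat_neg]; exact ih hψ _ T
  | or ψ θ ih₁ ih₂ =>
    have hψ₁ : ψ.vars ⊆ Set.Iio N := fun x hx => hψ (.inl hx)
    have hψ₂ : θ.vars ⊆ Set.Iio N := fun x hx => hψ (.inr hx)
    cases d
    · constructor
      · rintro ⟨h₁, h₂⟩
        obtain ⟨S₁, e₁, c₁⟩ := (ih₁ hψ₁ _ _).1 h₁
        obtain ⟨S₂, e₂, c₂⟩ := (ih₂ hψ₂ _ _).1 h₂
        exact ⟨fun i => Option.elim i T (Sum.elim S₁ S₂), rfl,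
          ⟨congrArg cylinder e₁, congrArg cylinder e₂⟩, c₁, c₂⟩
      · rintro ⟨S, rfl, ⟨e₁, e₂⟩, c₁, c₂⟩
        exact ⟨e₁ ▸ (ih₁ hψ₁ _ _).2 ⟨_, rfl, c₁⟩, e₂ ▸ (ih₂ hψ₂ _ _).2 ⟨_, rfl, c₂⟩⟩
    · constructor
      · rintro ⟨Y, Z, e, h₁, h₂⟩
        obtain ⟨S₁, e₁, c₁⟩ := (ih₁ hψ₁ _ _).1 (h₁.cylinder_restrictTeam hψ₁)
        obtain ⟨S₂, e₂, c₂⟩ := (ih₂ hψ₂ _ _).1 (h₂.cylinder_restrictTeam hψ₂)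
        refine ⟨fun i => Option.elim i T (Sum.elim S₁ S₂), rfl, ?_, c₁, c₂⟩
        change cylinder T = cylinder (S₁ ψ.root) ∪ cylinder (S₂ θ.root)
        rw [e₁, e₂]
        ext s'
        simp only [Set.mem_union, mem_cylinder_restrictTeam]
        constructor
        · intro hs
          rw [e] at hs
          exact hs.imp (fun h => ⟨s', h, fun _ _ => rfl⟩) (fun h => ⟨s', h, fun _ _ => rfl⟩)
        · rintro (⟨s, hs, e'⟩ | ⟨s, hs, e'⟩)
          · exact (mem_cylinder_congr e').1 (e ▸ .inl hs)
          · exact (mem_cylinder_congr e').1 (e ▸ .inr hs)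
      · rintro ⟨S, rfl, e, c₁, c₂⟩
        exact ⟨_, _, e, (ih₁ hψ₁ _ _).2 ⟨_, rfl, c₁⟩, (ih₂ hψ₂ _ _).2 ⟨_, rfl, c₂⟩⟩
  | ex v ψ ih =>
    have hψ' : ψ.vars ⊆ Set.Iio N := fun x hx => hψ (.inr hx)
    have hv : insert v (Set.Iio N) = Set.Iio N := Set.insert_eq_of_mem (hψ (.inl rfl))
    have hup : ∀ {s s' : ℕ → M.Dom} (m : M.Dom), Set.EqOn s s' (Set.Iio N) →
        Set.EqOn (Function.update s v m) (Function.update s' v m) (Set.Iio N) := by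
      intro s s' m e
      have := e.update_insert v m
      rwa [hv] at this
    cases d
    · constructor
      · intro h
        change TeamSat M false (teamSupAll (cylinder T) v) ψ at h
        have key : cylinder (restrictTeam N (teamSupAll (cylinder T) v)) =
            teamSupAll (cylinder T) v := by
          refine exists_cylinder_eq ?_
          rintro _ s' e ⟨s, hs, m, rfl⟩
          refine ⟨Function.update s' v (s v), ?_, s' v, by simp⟩
          refine (mem_cylinder_congr ?_).1 hs
          simpa using hup (s v) e
        rw [← key] at h
        obtain ⟨S, e, c⟩ := (ih hψ' _ _).1 h
        refine ⟨fun i => Option.elim i T S, rfl, ?_, c⟩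
        change cylinder (S ψ.root) = teamSupAll (cylinder T) v
        rw [e, key]
      · rintro ⟨S, rfl, e, c⟩
        change TeamSat M false (teamSupAll (cylinder (S none)) v) ψ
        rw [← e]
        exact (ih hψ' _ _).2 ⟨_, rfl, c⟩
    · rw [TeamSat_ex]
      constructor
      · rintro ⟨X', ⟨h₁, h₂⟩, h⟩
        obtain ⟨S, e, c⟩ := (ih hψ' _ _).1 (h.cylinder_restrictTeam hψ')
        refine ⟨fun i => Option.elim i T S, rfl, ?_, c⟩
        change IsSupplement (cylinder T) (cylinder (S ψ.root)) v
        rw [e]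
        refine ⟨fun s hs => ?_, fun s' hs' => ?_⟩
        · obtain ⟨m, hm⟩ := h₁ s hs
          exact ⟨m, mem_cylinder_restrictTeam.2 ⟨_, hm, fun _ _ => rfl⟩⟩
        · obtain ⟨_, hr, e'⟩ := mem_cylinder_restrictTeam.1 hs'
          obtain ⟨s, hs, m, rfl⟩ := h₂ _ hr
          refine ⟨Function.update s' v (s v), (mem_cylinder_congr ?_).1 hs, s' v, by simp⟩
          simpa using hup (s v) e'
      · rintro ⟨S, rfl, h, c⟩
        exact ⟨_, h, (ih hψ' _ _).2 ⟨_, rfl, c⟩⟩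

end Cylinder

section Translation

variable {k N : ℕ}

/-- The atom expressing that the assignment belongs to the team with index `i`. -/
def memTeam (N : ℕ) (i : Fin k) (n : ℕ) : DLFormula (Sig.addRels k fun _ => N) :=
  .rel (Sig := Sig.addRels k fun _ => N) (.inr i) fun j : Fin N => .var (j + n)

/-- First-order description of `TeamCert`, where the relation symbol `e i` stands for the
team with index `i`. -/
def certFormula (N : ℕ) : (ψ : DLFormula Sig) → Bool → (ψ.TeamIdx → Fin k) →
    DLFormula (Sig.addRels k fun _ => N)
  | .rel R ts, d, e => (memTeam N (e ()) 0).imp <| .lit d <|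
      .rel (Sig := Sig.addRels k fun _ => N) (.inl R) fun i => (ts i).lift k _ 0
  | .eq t₁ t₂, d, e => (memTeam N (e ()) 0).imp <| .lit d <|
      .eq (t₁.lift k _ 0) (t₂.lift k _ 0)
  | .dep n m ts₁ ts₂, true, e =>
      (memTeam N (e ()) 0).imp <| (memTeam N (e ()) N).imp <|
        (DLFormula.bigConj <| (List.finRange n).map fun i =>
          .eq ((ts₁ i).lift k _ 0) ((ts₁ i).lift k _ N)).imp <|
        DLFormula.bigConj <| (List.finRange m).map fun i =>
          .eq ((ts₂ i).lift k _ 0) ((ts₂ i).lift k _ N)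
  | .dep _ _ _ _, false, e => (memTeam N (e ()) 0).neg
  | .neg ψ, d, e => certFormula N ψ (!d) e
  | .or ψ θ, true, e =>
      ((memTeam N (e none) 0).biimp <|
        (memTeam N (e (some (.inl ψ.root))) 0).or (memTeam N (e (some (.inr θ.root))) 0)).conj <|
      (certFormula N ψ true fun i => e (some (.inl i))).conj
        (certFormula N θ true fun i => e (some (.inr i)))
  | .or ψ θ, false, e =>
      (((memTeam N (e (some (.inl ψ.root))) 0).biimp (memTeam N (e none) 0)).conj
        ((memTeam N (e (some (.inr θ.root))) 0).biimp (memTeam N (e none) 0))).conj <|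
      (certFormula N ψ false fun i => e (some (.inl i))).conj
        (certFormula N θ false fun i => e (some (.inr i)))
  | .ex v ψ, true, e =>
      (((memTeam N (e none) 0).imp (.ex v (memTeam N (e (some ψ.root)) 0))).conj
        ((memTeam N (e (some ψ.root)) 0).imp (.ex v (memTeam N (e none) 0)))).conj <|
      certFormula N ψ true fun i => e (some i)
  | .ex v ψ, false, e =>
      ((memTeam N (e (some ψ.root)) 0).biimp (.ex v (memTeam N (e none) 0))).conj <|
      certFormula N ψ false fun i => e (some i)

theorem isFirstOrder_certFormula (ψ : DLFormula Sig) (d : Bool) (e : ψ.TeamIdx → Fin k) :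
    (certFormula N ψ d e).IsFirstOrder := by
  induction ψ generalizing d with
  | neg ψ ih => exact ih _ _
  | _ =>
    cases d <;>
    simp_all [certFormula, DLFormula.imp, DLFormula.biimp, memTeam, DLFormula.IsFirstOrder,
      DLFormula.isFirstOrder_conj, DLFormula.isFirstOrder_bigConj, DLFormula.lit]

variable {M : Model Sig} {S : Fin k → (Fin N → M.Dom) → Prop} {s : ℕ → M.Dom}

theorem TarskiExp_imp {ar : Fin k → ℕ} {S : ∀ i : Fin k, (Fin (ar i) → M.Dom) → Prop}
    {ψ θ : DLFormula (Sig.addRels k ar)} :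
    TarskiExp M S s (ψ.imp θ) ↔ (TarskiExp M S s ψ → TarskiExp M S s θ) := by
  rw [DLFormula.imp, TarskiExp_or, TarskiExp_neg, imp_iff_not_or]

theorem TarskiExp_biimp {ar : Fin k → ℕ} {S : ∀ i : Fin k, (Fin (ar i) → M.Dom) → Prop}
    {ψ θ : DLFormula (Sig.addRels k ar)} :
    TarskiExp M S s (ψ.biimp θ) ↔ (TarskiExp M S s ψ ↔ TarskiExp M S s θ) := by
  rw [DLFormula.biimp, TarskiExp_conj, TarskiExp_imp, TarskiExp_imp]
  exact iff_iff_implies_and_implies.symm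

theorem TarskiExp_memTeam {i : Fin k} {n : ℕ} :
    TarskiExp M S s (memTeam N i n) ↔ (fun j => s (j + n)) ∈ cylinder (S i) := Iff.rfl

theorem isSupplement_iff {X X' : Set (ℕ → M.Dom)} {v : ℕ} :
    IsSupplement X X' v ↔ ∀ s, (s ∈ X → ∃ m, Function.update s v m ∈ X') ∧
      (s ∈ X' → ∃ m, Function.update s v m ∈ X) := by
  rw [forall_and]
  refine and_congr Iff.rfl (forall_congr' fun s' => imp_congr_right fun _ => ?_)
  constructor
  · rintro ⟨s, hs, m, rfl⟩
    exact ⟨s v, by simpa using hs⟩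
  · rintro ⟨m, hm⟩
    exact ⟨_, hm, s' v, by simp⟩

theorem mem_teamSupAll {X : Set (ℕ → M.Dom)} {v : ℕ} :
    s ∈ teamSupAll X v ↔ ∃ m, Function.update s v m ∈ X := by
  constructor
  · rintro ⟨r, hr, m, rfl⟩
    exact ⟨r v, by simpa using hr⟩
  · rintro ⟨m, hm⟩
    exact ⟨_, hm, s v, by simp⟩

theorem forall_TarskiExp_certFormula {ψ : DLFormula Sig} (hψ : ψ.vars ⊆ Set.Iio N) (d : Bool)
    (e : ψ.TeamIdx → Fin k) :
    (∀ s, TarskiExp M S s (certFormula N ψ d e)) ↔ TeamCert M N ψ d fun i => S (e i) := by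
  induction ψ generalizing d with
  | rel R ts =>
    have hFO : (DLFormula.rel R ts).IsFirstOrder := trivial
    have key : ∀ s : ℕ → M.Dom, TarskiExp M S s (.rel (Sig := Sig.addRels k fun _ => N) (.inl R)
        fun i => (ts i).lift k _ 0) ↔ Tarski M s (.rel R ts) := fun s =>
      iff_of_eq (congrArg (M.relInterp R) (funext fun i => (ts i).eval_lift 0))
    simp only [certFormula, TarskiExp_imp, TarskiExp_lit, TarskiExp_memTeam, key, TeamCert,
      TeamSat_iff_forall_Tarski hFO]
    rfl
  | eq t₁ t₂ =>
    have hFO : (DLFormula.eq t₁ t₂).IsFirstOrder := trivial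
    simp only [certFormula, TarskiExp_imp, TarskiExp_lit, TarskiExp_memTeam, TarskiExp_eq,
      Term.eval_lift, TeamCert, TeamSat_iff_forall_Tarski hFO]
    rfl
  | dep n m ts₁ ts₂ =>
    cases d
    · simp only [certFormula, TarskiExp_neg, TarskiExp_memTeam, TeamCert, TeamSat,
        Set.eq_empty_iff_forall_notMem]
      rfl
    · simp only [certFormula, TarskiExp_imp, TarskiExp_memTeam, TarskiExp_bigConj,
        List.forall_mem_map, List.mem_finRange, true_implies, TarskiExp_eq, Term.eval_lift,
        TeamCert, TeamSat]
      constructor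
      · intro h s hs s' hs'
        let r : ℕ → M.Dom := fun i => if i < N then s i else s' (i - N)
        have hr : Set.EqOn (fun i => r (i + 0)) s (Set.Iio N) := fun i hi => if_pos hi
        have hr' : (fun i => r (i + N)) = s' := by funext i; simp [r]
        have h₁ : ∀ i, (ts₁ i).eval M (fun i => r (i + 0)) = (ts₁ i).eval M s := fun i =>
          (ts₁ i).eval_congr (hr.mono fun x hx => hψ (.inl (Set.mem_iUnion_of_mem i hx)))
        have h₂ : ∀ i, (ts₂ i).eval M (fun i => r (i + 0)) = (ts₂ i).eval M s := fun i =>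
          (ts₂ i).eval_congr (hr.mono fun x hx => hψ (.inr (Set.mem_iUnion_of_mem i hx)))
        have := h r ((mem_cylinder_congr hr).2 hs) (hr' ▸ hs')
        simp only [hr', h₁, h₂] at this
        exact this
      · exact fun h s hs hs' => h _ hs _ hs'
  | neg ψ ih => exact ih hψ _ _
  | or ψ θ ih₁ ih₂ =>
    have hψ₁ : ψ.vars ⊆ Set.Iio N := fun x hx => hψ (.inl hx)
    have hψ₂ : θ.vars ⊆ Set.Iio N := fun x hx => hψ (.inr hx)
    cases d <;>
    simp only [certFormula, TarskiExp_conj, TarskiExp_biimp, TarskiExp_or, TarskiExp_memTeam,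
      forall_and, ih₁ hψ₁, ih₂ hψ₂, TeamCert, Set.ext_iff, Set.mem_union] <;> rfl
  | ex v ψ ih =>
    have hψ' : ψ.vars ⊆ Set.Iio N := fun x hx => hψ (.inr hx)
    cases d <;>
    simp only [certFormula, TarskiExp_conj, TarskiExp_biimp, TarskiExp_imp, TarskiExp_ex,
      TarskiExp_memTeam, forall_and, ih hψ', TeamCert, Set.ext_iff, mem_teamSupAll,
      isSupplement_iff] <;> rfl

end Translation

theorem exists_universal_sentence (φ : DLFormula Sig) (hφ : φ.free = ∅) :
    ∃ (k : ℕ) (ar : Fin k → ℕ) (Ψ : DLFormula (Sig.addRels k ar)),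
      Ψ.IsFirstOrder ∧ Ψ.free = ∅ ∧
      ∀ M : Model Sig,
        (M.psat true φ ↔
          ∀ (S : ∀ i : Fin k, (Fin (ar i) → M.Dom) → Prop) (s : ℕ → M.Dom),
            Tarski (M.addRels k ar S) s Ψ) := by
  obtain ⟨N, hN⟩ := φ.exists_vars_subset_Iio
  have := φ.finite_teamIdx
  obtain ⟨k, ⟨e⟩⟩ := Finite.exists_equiv_fin φ.TeamIdx
  set θ := (memTeam N (e φ.root) 0).conj (certFormula N φ false e) with hθ
  obtain ⟨l, hl⟩ := θ.exists_free_alls_eq_empty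
  refine ⟨k, fun _ => N, (θ.alls l).neg, ?_, hl, fun M => ?_⟩
  · exact (DLFormula.isFirstOrder_alls l θ).2
      ((DLFormula.isFirstOrder_conj _ _).2 ⟨trivial, isFirstOrder_certFormula φ false e⟩)
  have key : ∀ (S : Fin k → (Fin N → M.Dom) → Prop) (s : ℕ → M.Dom),
      Tarski (M.addRels k (fun _ => N) S) s (θ.alls l).neg ↔
        ¬ (S (e φ.root) = (fun _ => True) ∧ TeamCert M N φ false fun i => S (e i)) := by
    intro S s
    refine not_congr ((Tarski_alls_iff_forall (M := M.addRels k (fun _ => N) S) hl s).trans ?_)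
    rw [← forall_TarskiExp_certFormula hN]
    change (∀ s', TarskiExp M S s' θ) ↔ _
    simp only [hθ, TarskiExp_conj, forall_and, TarskiExp_memTeam]
    refine and_congr_left fun _ => ⟨fun h => funext fun t => ?_, fun h s => ?_⟩
    · have := h fun i => if hi : i < N then t ⟨i, hi⟩ else M.defAsg 0
      simpa [cylinder] using this
    · simp [cylinder, h]
  have hsat : TeamSat M false {M.defAsg} φ ↔
      TeamSat M false (cylinder fun _ : Fin N → M.Dom => True) φ := by
    constructor <;> refine TeamSat.congr hφ.le ⟨?_, ?_⟩ <;> intro s _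
    · exact ⟨s, trivial, by simp⟩
    · exact ⟨_, rfl, by simp⟩
    · exact ⟨_, rfl, by simp⟩
    · exact ⟨s, trivial, by simp⟩
  change ¬ TeamSat M false {M.defAsg} φ ↔ ∀ (S : Fin k → (Fin N → M.Dom) → Prop) (s : ℕ → M.Dom), _
  rw [hsat, TeamSat_cylinder_iff hN, not_exists]
  simp only [key]
  constructor
  · exact fun h S _ => h fun i => S (e i)
  · intro h S
    have := h (fun i => S (e.symm i)) M.defAsg
    simpa using this

/-! ## From existential second-order logic to Dependence Logic -/

section Converse

variable {k : ℕ} {ar : Fin k → ℕ}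

/-- Replace every atom of the `i`-th new relation symbol by the truth value `P i`. -/
def DLFormula.substConst (P : Fin k → Bool) : DLFormula (Sig.addRels k ar) → DLFormula Sig
  | .rel (.inl R) ts => .rel (Sig := Sig) R fun i => (ts i).lower
  | .rel (.inr i) _ => .lit (P i) .top
  | .eq t₁ t₂ => .eq t₁.lower t₂.lower
  | .dep _ _ _ _ => .top
  | .neg ψ => (ψ.substConst P).neg
  | .or ψ θ => (ψ.substConst P).or (θ.substConst P)
  | .ex v ψ => .ex v (ψ.substConst P)

theorem DLFormula.isFirstOrder_substConst (P : Fin k → Bool)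
    (ψ : DLFormula (Sig.addRels k ar)) : (ψ.substConst P).IsFirstOrder := by
  induction ψ with
  | rel R ts =>
    rcases R with R | i
    · trivial
    · exact (isFirstOrder_lit _ _).2 trivial
  | eq t₁ t₂ => trivial
  | dep n m ts₁ ts₂ => trivial
  | neg ψ ih => exact ih
  | or ψ θ ih₁ ih₂ => exact ⟨ih₁, ih₂⟩
  | ex v ψ ih => exact ih

theorem Tarski_top {M : Model Sig} {s : ℕ → M.Dom} : Tarski M s .top := rfl

theorem Tarski_substConst {M : Model Sig} {s : ℕ → M.Dom} (P : Fin k → Bool)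
    (ψ : DLFormula (Sig.addRels k ar)) :
    Tarski M s (ψ.substConst P) ↔ TarskiExp M (fun i _ => P i = true) s ψ := by
  induction ψ generalizing s with
  | rel R ts =>
    rcases R with R | i
    · exact iff_of_eq (congrArg (M.relInterp R) (funext fun i => (ts i).eval_lower))
    · refine Tarski_lit.trans ?_
      simp only [Tarski_top, true_iff]
      rfl
  | eq t₁ t₂ =>
    change t₁.lower.eval M s = t₂.lower.eval M s ↔ _
    rw [t₁.eval_lower, t₂.eval_lower]; rfl
  | dep n m ts₁ ts₂ => exact iff_of_true Tarski_top trivial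
  | neg ψ ih => exact not_congr ih
  | or ψ θ ih₁ ih₂ => exact or_congr ih₁ ih₂
  | ex v ψ ih => exact exists_congr fun m => ih

/-- The disjunction of all replacements of new relation symbols by truth values. -/
noncomputable def DLFormula.someConst (ψ : DLFormula (Sig.addRels k ar)) : DLFormula Sig :=
  (DLFormula.bigConj <| (Finset.univ : Finset (Fin k → Bool)).toList.map fun P =>
    (ψ.substConst P).neg).neg

theorem DLFormula.isFirstOrder_someConst (ψ : DLFormula (Sig.addRels k ar)) :
    ψ.someConst.IsFirstOrder := by
  refine (isFirstOrder_bigConj _).2 ?_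
  rw [List.forall_mem_map]
  exact fun P _ => ψ.isFirstOrder_substConst P

theorem Tarski_someConst {M : Model Sig} {s : ℕ → M.Dom} [Subsingleton M.Dom]
    (ψ : DLFormula (Sig.addRels k ar)) :
    Tarski M s ψ.someConst ↔ ∃ S, TarskiExp M S s ψ := by
  change (¬ Tarski M s (.bigConj _)) ↔ _
  rw [Tarski_bigConj, List.forall_mem_map]
  simp only [Finset.mem_toList, Finset.mem_univ, true_implies, Tarski, Tarski_substConst,
    not_forall, not_not]
  refine ⟨fun ⟨P, h⟩ => ⟨_, h⟩, fun ⟨S, h⟩ => ?_⟩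
  classical
  refine ⟨fun i => decide (S i fun _ => s 0), ?_⟩
  convert h using 3 with i t
  rw [decide_eq_true_iff, Subsingleton.elim t fun _ => s 0]

/-- Evaluation of a first-order formula `ψ` or its negation (according to the Boolean) in
variables below `B`, where the choices made during the evaluation depend only on these variables,
and atoms of the `i`-th new relation symbol are read off the value of the variable `B + 2 + A + i`
(as compared with the variable `B`), seen as a function of the variables `B + 2 + j`, `j < A`. -/
def DLFormula.uniformEval (B A : ℕ) : DLFormula (Sig.addRels k ar) → Bool → DLFormula Sig
  | .rel (.inl R) ts, d => .lit d (.rel (Sig := Sig) R fun i => (ts i).lower)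
  | .rel (.inr i) ts, d =>
      (DLFormula.bigConj <| (List.finRange (ar i)).map fun j : Fin (ar i) =>
        .eq (.var (B + 2 + j)) (ts j).lower).imp <|
      .lit d (.eq (.var (B + 2 + A + i)) (.var B))
  | .eq t₁ t₂, d => .lit d (.eq t₁.lower t₂.lower)
  | .dep _ _ _ _, _ => .top
  | .neg ψ, d => ψ.uniformEval B A (!d)
  | .or ψ θ, true =>
      .ex (B + 1) <|
        (DLFormula.dep B 1 (fun j => .var j) (fun _ => .var (B + 1))).conj <|
        ((DLFormula.eq (.var (B + 1)) (.var B)).conj (ψ.uniformEval B A true)).or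
          ((DLFormula.eq (.var (B + 1)) (.var B)).neg.conj (θ.uniformEval B A true))
  | .or ψ θ, false => (ψ.uniformEval B A false).conj (θ.uniformEval B A false)
  | .ex v ψ, true =>
      .ex v <|
        (DLFormula.dep B 1 (fun j => .var (if j = v then B else j)) (fun _ => .var v)).conj
          (ψ.uniformEval B A true)
  | .ex v ψ, false => .all v (ψ.uniformEval B A false)

variable {M : Model Sig} {B A : ℕ} {c : M.Dom} {S : ∀ i : Fin k, (Fin (ar i) → M.Dom) → Prop}
  {X X' : Set (ℕ → M.Dom)}

/-- The assignment `s` encodes the values of the relations `S` at its variables `B + 2 + j`. -/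
def IsCode (B A : ℕ) (c : M.Dom) (S : ∀ i : Fin k, (Fin (ar i) → M.Dom) → Prop)
    (s : ℕ → M.Dom) : Prop :=
  s B = c ∧ ∀ i : Fin k, s (B + 2 + A + i) = c ↔ S i fun j => s (B + 2 + j)

theorem IsCode.update {s : ℕ → M.Dom} (h : IsCode B A c S s) {v : ℕ} (hv : v < B ∨ v = B + 1)
    (m : M.Dom) : IsCode B A c S (Function.update s v m) := by
  have h₁ : ∀ n, B ≤ n → n ≠ B + 1 → Function.update s v m n = s n := fun n hn hn' =>
    Function.update_of_ne (by omega) _ _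
  refine ⟨by rw [h₁ B (by omega) (by omega), h.1], fun i => ?_⟩
  rw [h₁ _ (by omega) (by omega), h.2]
  refine iff_of_eq (congrArg (S i) (funext fun j => ?_))
  rw [h₁ _ (by omega) (by omega)]

/-- The variables `B + 2 + j` take all values independently of the variables in `V`. -/
def IsRich (B A : ℕ) (V : Set ℕ) (X : Set (ℕ → M.Dom)) : Prop :=
  ∀ s ∈ X, ∀ t : ℕ → M.Dom, ∃ s' ∈ X, Set.EqOn s s' V ∧ ∀ j < A, s' (B + 2 + j) = t j

theorem IsRich.mono {V W : Set ℕ} (h : IsRich B A W X) (hVW : V ⊆ W) : IsRich B A V X := by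
  intro s hs t
  obtain ⟨s', hs', e, h'⟩ := h s hs t
  exact ⟨s', hs', e.mono hVW, h'⟩

theorem IsRich.supplement {v : ℕ} (hX : IsRich B A (Set.Iio B) X) (hv : v < B ∨ v = B + 1)
    (h : IsSupplement X X' v)
    (hdep : ∀ s ∈ X', ∀ s' ∈ X', Set.EqOn s s' (Set.Iio B \ {v}) → s v = s' v) :
    IsRich B A (insert v (Set.Iio B)) X' := by
  intro r hr t
  obtain ⟨s, hs, m, rfl⟩ := h.2 r hr
  obtain ⟨s', hs', e, h'⟩ := hX s hs t
  obtain ⟨m', hm'⟩ := h.1 s' hs'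
  have hm : m = m' := by
    have := hdep _ hr _ hm' fun x hx => by
      have hxv : x ≠ v := hx.2
      simpa [hxv] using e hx.1
    simpa using this
  subst hm
  refine ⟨_, hm', e.update_insert v m, fun j hj => ?_⟩
  rw [Function.update_of_ne (by omega), h' j hj]

theorem IsRich.teamSupAll {v : ℕ} (hX : IsRich B A (Set.Iio B) X) (hv : v < B) :
    IsRich B A (Set.Iio B) (teamSupAll X v) := by
  rintro _ ⟨s, hs, m, rfl⟩ t
  obtain ⟨s', hs', e, h'⟩ := hX s hs t
  refine ⟨_, ⟨s', hs', m, rfl⟩, (e.update_insert v m).mono (Set.subset_insert _ _), fun j hj => ?_⟩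
  rw [Function.update_of_ne (by omega), h' j hj]

theorem TeamSat_dep_one {n : ℕ} {ts : Fin n → Term Sig} {v : ℕ} :
    TeamSat M true X (.dep n 1 ts fun _ => .var v) ↔
      ∀ s ∈ X, ∀ s' ∈ X, (∀ i, (ts i).eval M s = (ts i).eval M s') → s v = s' v := by
  simp [TeamSat, Term.eval]

theorem TarskiExp_congr_of_vars {ψ : DLFormula (Sig.addRels k ar)} (hψ : ψ.vars ⊆ Set.Iio B)
    {s s' : ℕ → M.Dom} (h : Set.EqOn s s' (Set.Iio B)) :
    TarskiExp M S s ψ ↔ TarskiExp M S s' ψ :=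
  TarskiExp_congr ψ (h.mono (ψ.free_subset_vars.trans hψ))

theorem TarskiExp_of_uniformEval {ψ : DLFormula (Sig.addRels k ar)} (hA : ∀ i, ar i ≤ A)
    (hFO : ψ.IsFirstOrder) (hψ : ψ.vars ⊆ Set.Iio B) {d : Bool}
    (h : TeamSat M true X (ψ.uniformEval B A d)) (hcode : ∀ s ∈ X, IsCode B A c S s)
    (hrich : IsRich B A (Set.Iio B) X) : ∀ s ∈ X, (TarskiExp M S s ψ ↔ d = true) := by
  induction ψ generalizing d X with
  | rel R ts =>
    intro s hs
    rcases R with R | i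
    · have hlit : (DLFormula.lit d
        (DLFormula.rel (Sig := Sig) R fun i => (ts i).lower)).IsFirstOrder :=
          (DLFormula.isFirstOrder_lit _ _).2 trivial
      have := ((TeamSat_iff_forall_Tarski hlit true).1 h s hs).2 rfl
      rw [Tarski_lit] at this
      refine Iff.trans ?_ this
      exact iff_of_eq (congrArg (M.relInterp R) (funext fun i => (ts i).eval_lower.symm))
    · let t : ℕ → M.Dom := fun j =>
        if hj : j < ar i then (ts ⟨j, hj⟩).lower.eval M s else c
      obtain ⟨s', hs', e, ht⟩ := hrich s hs t
      have hts : ∀ j : Fin (ar i), s' (B + 2 + j) = (ts j).lower.eval M s := fun j => by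
        have hj : (j : ℕ) < ar i := j.2
        rw [ht j (hj.trans_le (hA i))]
        exact dif_pos hj
      have hFO' : (DLFormula.uniformEval B A
          (.rel (Sig := Sig.addRels k ar) (.inr i) ts) d).IsFirstOrder := by
        refine ⟨(DLFormula.isFirstOrder_bigConj _).2 ?_,
          (DLFormula.isFirstOrder_lit _ _).2 trivial⟩
        rw [List.forall_mem_map]
        exact fun _ _ => trivial
      have h' := ((TeamSat_iff_forall_Tarski hFO' true).1 h s' hs').2 rfl
      have hcond : Tarski M s' (DLFormula.bigConj <|
          (List.finRange (ar i)).map fun j : Fin (ar i) =>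
            DLFormula.eq (.var (B + 2 + j)) (ts j).lower) := by
        rw [Tarski_bigConj, List.forall_mem_map]
        intro j _
        change s' (B + 2 + j) = (ts j).lower.eval M s'
        rw [hts]
        refine Term.eval_congr _ (e.mono ?_)
        rw [Term.vars_lower]
        exact fun x hx => hψ (Set.mem_iUnion_of_mem j hx)
      have h'' := Tarski_lit.1 (h'.resolve_left (not_not_intro hcond))
      refine Iff.trans ?_ h''
      change _ ↔ s' (B + 2 + A + i) = s' B
      rw [(hcode s' hs').1, (hcode s' hs').2]
      refine iff_of_eq (congrArg (S i) (funext fun j => ?_))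
      exact ((hts j).trans (ts j).eval_lower).symm
  | eq t₁ t₂ =>
    intro s hs
    have hlit : (DLFormula.lit d (DLFormula.eq t₁.lower t₂.lower)).IsFirstOrder :=
      (DLFormula.isFirstOrder_lit _ _).2 trivial
    have := ((TeamSat_iff_forall_Tarski hlit true).1 h s hs).2 rfl
    rw [Tarski_lit] at this
    refine Iff.trans ?_ this
    rw [TarskiExp_eq, ← Term.eval_lower, ← Term.eval_lower]
    rfl
  | dep n m ts₁ ts₂ => exact hFO.elim
  | neg ψ ih =>
    intro s hs
    rw [TarskiExp_neg, ih hFO hψ h hcode hrich s hs]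
    cases d <;> simp
  | or ψ θ ih₁ ih₂ =>
    have hψ₁ : ψ.vars ⊆ Set.Iio B := fun x hx => hψ (.inl hx)
    have hψ₂ : θ.vars ⊆ Set.Iio B := fun x hx => hψ (.inr hx)
    cases d
    · intro s hs
      obtain ⟨h₁, h₂⟩ := TeamSat_conj.1 h
      rw [TarskiExp_or, ih₁ hFO.1 hψ₁ h₁ hcode hrich s hs, ih₂ hFO.2 hψ₂ h₂ hcode hrich s hs]
      simp
    · obtain ⟨X', hsup, h⟩ := TeamSat_ex.1 h
      obtain ⟨hdep, Y, Z, hYZ, hY, hZ⟩ := TeamSat_conj.1 h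
      obtain ⟨hYu, hY⟩ := TeamSat_conj.1 hY
      obtain ⟨hZu, hZ⟩ := TeamSat_conj.1 hZ
      rw [TeamSat_dep_one] at hdep
      have hrich' := hrich.supplement (.inr rfl) hsup fun s hs s' hs' e =>
        hdep s hs s' hs' fun j => e ⟨j.2, by have := j.2; simp; omega⟩
      have hcode' : ∀ s ∈ X', IsCode B A c S s := by
        intro r hr
        obtain ⟨s, hs, m, rfl⟩ := hsup.2 r hr
        exact (hcode s hs).update (.inr rfl) m
      have hu : ∀ {s s' : ℕ → M.Dom}, s ∈ X' → s' ∈ X' →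
          Set.EqOn s s' (insert (B + 1) (Set.Iio B)) →
          (s (B + 1) = s B ↔ s' (B + 1) = s' B) := by
        intro s s' hs hs' e
        rw [(hcode' s hs).1, (hcode' s' hs').1, e (.inl rfl)]
      have hYX : ∀ {s}, s ∈ Y → s ∈ X' := fun hs => hYZ ▸ .inl hs
      have hZX : ∀ {s}, s ∈ Z → s ∈ X' := fun hs => hYZ ▸ .inr hs
      have hYr : IsRich B A (Set.Iio B) Y := by
        intro s hs t
        obtain ⟨s', hs', e, h'⟩ := hrich' s (hYX hs) t
        refine ⟨s', ?_, e.mono (Set.subset_insert _ _), h'⟩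
        have h₁ := (hu (hYX hs) hs' e).1 (hYu s hs)
        rw [hYZ] at hs'
        exact hs'.resolve_right fun hs'' => hZu s' hs'' h₁
      have hZr : IsRich B A (Set.Iio B) Z := by
        intro s hs t
        obtain ⟨s', hs', e, h'⟩ := hrich' s (hZX hs) t
        refine ⟨s', ?_, e.mono (Set.subset_insert _ _), h'⟩
        have h₁ := fun h => hZu s hs ((hu (hZX hs) hs' e).2 h)
        rw [hYZ] at hs'
        exact hs'.resolve_left fun hs'' => h₁ (hYu s' hs'')
      intro s hs
      obtain ⟨m, hm⟩ := hsup.1 s hs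
      have e : Set.EqOn s (Function.update s (B + 1) m) (Set.Iio B) := fun x hx => by
        rw [Function.update_of_ne (by have : x < B := hx; omega)]
      rw [TarskiExp_or, TarskiExp_congr_of_vars hψ₁ e, TarskiExp_congr_of_vars hψ₂ e]
      simp only [iff_true]
      rw [hYZ] at hm
      rcases hm with hm | hm
      · exact .inl ((ih₁ hFO.1 hψ₁ hY (fun s hs => hcode' s (hYX hs)) hYr _ hm).2 rfl)
      · exact .inr ((ih₂ hFO.2 hψ₂ hZ (fun s hs => hcode' s (hZX hs)) hZr _ hm).2 rfl)
  | ex v ψ ih =>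
    have hψ' : ψ.vars ⊆ Set.Iio B := fun x hx => hψ (.inr hx)
    have hv : v < B := hψ (.inl rfl)
    cases d
    · intro s hs
      have h' := ih hFO hψ' (TeamSat_all.1 h)
        (by rintro _ ⟨s, hs, m, rfl⟩; exact (hcode s hs).update (.inl hv) m)
        (hrich.teamSupAll hv)
      rw [TarskiExp_ex]
      simpa using fun m => h' _ ⟨s, hs, m, rfl⟩
    · obtain ⟨X', hsup, h⟩ := TeamSat_ex.1 h
      obtain ⟨hdep, h⟩ := TeamSat_conj.1 h
      rw [TeamSat_dep_one] at hdep
      have hcode' : ∀ s ∈ X', IsCode B A c S s := by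
        intro r hr
        obtain ⟨s, hs, m, rfl⟩ := hsup.2 r hr
        exact (hcode s hs).update (.inl hv) m
      have hrich' := hrich.supplement (.inl hv) hsup fun s hs s' hs' e =>
        hdep s hs s' hs' fun j => by
          simp only [Term.eval]
          split_ifs with hj
          · rw [(hcode' s hs).1, (hcode' s' hs').1]
          · exact e ⟨j.2, hj⟩
      intro s hs
      obtain ⟨m, hm⟩ := hsup.1 s hs
      rw [TarskiExp_ex]
      exact iff_of_true
        ⟨m, (ih hFO hψ' h hcode' (hrich'.mono (Set.subset_insert _ _)) _ hm).2 rfl⟩ rfl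

theorem uniformEval_of_TarskiExp {ψ : DLFormula (Sig.addRels k ar)} {a : M.Dom} (ha : a ≠ c)
    (hψ : ψ.vars ⊆ Set.Iio B) {d : Bool} (hcode : ∀ s ∈ X, IsCode B A c S s)
    (h : ∀ s ∈ X, (TarskiExp M S s ψ ↔ d = true)) :
    TeamSat M true X (ψ.uniformEval B A d) := by
  induction ψ generalizing d X with
  | rel R ts =>
    rcases R with R | i
    · have hlit : (DLFormula.lit d
        (DLFormula.rel (Sig := Sig) R fun i => (ts i).lower)).IsFirstOrder :=
          (DLFormula.isFirstOrder_lit _ _).2 trivial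
      refine (TeamSat_iff_forall_Tarski hlit true).2 fun s hs => iff_of_true ?_ rfl
      rw [Tarski_lit, ← h s hs]
      exact iff_of_eq (congrArg (M.relInterp R) (funext fun i => (ts i).eval_lower))
    · have hFO' : (DLFormula.uniformEval B A
          (.rel (Sig := Sig.addRels k ar) (.inr i) ts) d).IsFirstOrder := by
        refine ⟨(DLFormula.isFirstOrder_bigConj _).2 ?_,
          (DLFormula.isFirstOrder_lit _ _).2 trivial⟩
        rw [List.forall_mem_map]
        exact fun _ _ => trivial
      refine (TeamSat_iff_forall_Tarski hFO' true).2 fun s hs => iff_of_true ?_ rfl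
      refine or_iff_not_imp_left.2 fun hcond => ?_
      have hcond := not_not.1 hcond
      rw [Tarski_bigConj, List.forall_mem_map] at hcond
      rw [Tarski_lit, ← h s hs]
      change s (B + 2 + A + i) = s B ↔ _
      rw [(hcode s hs).1, (hcode s hs).2]
      refine iff_of_eq (congrArg (S i) (funext fun j => ?_))
      rw [← Term.eval_lower]
      exact hcond j (List.mem_finRange j)
  | eq t₁ t₂ =>
    have hlit : (DLFormula.lit d (DLFormula.eq t₁.lower t₂.lower)).IsFirstOrder :=
      (DLFormula.isFirstOrder_lit _ _).2 trivial
    refine (TeamSat_iff_forall_Tarski hlit true).2 fun s hs => iff_of_true ?_ rfl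
    rw [Tarski_lit, ← h s hs, TarskiExp_eq, ← Term.eval_lower, ← Term.eval_lower]
    rfl
  | dep n m ts₁ ts₂ => exact fun _ _ => rfl
  | neg ψ ih =>
    refine ih hψ hcode fun s hs => ?_
    have := h s hs
    rw [TarskiExp_neg] at this
    cases d <;> simpa using this
  | or ψ θ ih₁ ih₂ =>
    have hψ₁ : ψ.vars ⊆ Set.Iio B := fun x hx => hψ (.inl hx)
    have hψ₂ : θ.vars ⊆ Set.Iio B := fun x hx => hψ (.inr hx)
    simp only [TarskiExp_or] at h
    cases d
    · simp only [Bool.false_eq_true, iff_false, not_or] at h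
      exact TeamSat_conj.2 ⟨ih₁ hψ₁ hcode fun s hs => by simpa using (h s hs).1,
        ih₂ hψ₂ hcode fun s hs => by simpa using (h s hs).2⟩
    · classical
      let f : (ℕ → M.Dom) → M.Dom := fun s => if TarskiExp M S s ψ then c else a
      have e : ∀ (s : ℕ → M.Dom) (m : M.Dom),
          Set.EqOn (Function.update s (B + 1) m) s (Set.Iio B) := fun s m x hx => by
        rw [Function.update_of_ne (by have : x < B := hx; omega)]
      have hfc : ∀ s, f s = c ↔ TarskiExp M S s ψ := fun s => by
        by_cases hs : TarskiExp M S s ψ <;> simp [f, hs, ha]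
      refine TeamSat_ex.2 ⟨(fun s => Function.update s (B + 1) (f s)) '' X,
        ⟨fun s hs => ⟨f s, s, hs, rfl⟩, ?_⟩, TeamSat_conj.2 ⟨TeamSat_dep_one.2 ?_, ?_⟩⟩
      · rintro _ ⟨s, hs, rfl⟩
        exact ⟨s, hs, f s, rfl⟩
      · rintro _ ⟨s, hs, rfl⟩ _ ⟨s', hs', rfl⟩ hss'
        have : Set.EqOn s s' (Set.Iio B) := fun x hx => by
          have := hss' ⟨x, hx⟩
          simp only [Term.eval] at this
          rwa [e s _ hx, e s' _ hx] at this
        simp [f, TarskiExp_congr_of_vars hψ₁ this]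
      · refine ⟨(fun s => Function.update s (B + 1) (f s)) '' {s ∈ X | TarskiExp M S s ψ},
          (fun s => Function.update s (B + 1) (f s)) '' {s ∈ X | ¬ TarskiExp M S s ψ}, ?_,
          TeamSat_conj.2 ⟨?_, ih₁ hψ₁ ?_ ?_⟩, TeamSat_conj.2 ⟨?_, ih₂ hψ₂ ?_ ?_⟩⟩
        · rw [← Set.image_union]
          congr 1
          ext s
          by_cases hs : TarskiExp M S s ψ <;> simp [hs]
        · rintro _ ⟨s, ⟨hs, hs'⟩, rfl⟩
          simpa [Term.eval, (hcode s hs).1] using (hfc s).2 hs'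
        · rintro _ ⟨s, ⟨hs, hs'⟩, rfl⟩
          exact (hcode s hs).update (.inr rfl) _
        · rintro _ ⟨s, ⟨hs, hs'⟩, rfl⟩
          rw [TarskiExp_congr_of_vars hψ₁ (e s _)]
          exact iff_of_true hs' rfl
        · rintro _ ⟨s, ⟨hs, hs'⟩, rfl⟩
          simpa [Term.eval, (hcode s hs).1] using fun h => hs' ((hfc s).1 h)
        · rintro _ ⟨s, ⟨hs, hs'⟩, rfl⟩
          exact (hcode s hs).update (.inr rfl) _
        · rintro _ ⟨s, ⟨hs, hs'⟩, rfl⟩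
          rw [TarskiExp_congr_of_vars hψ₂ (e s _)]
          exact iff_of_true (((h s hs).2 rfl).resolve_left hs') rfl
  | ex v ψ ih =>
    have hψ' : ψ.vars ⊆ Set.Iio B := fun x hx => hψ (.inr hx)
    have hv : v < B := hψ (.inl rfl)
    simp only [TarskiExp_ex] at h
    cases d
    · refine TeamSat_all.2 (ih hψ' ?_ ?_)
      · rintro _ ⟨s, hs, m, rfl⟩
        exact (hcode s hs).update (.inl hv) m
      · rintro _ ⟨s, hs, m, rfl⟩
        exact iff_of_false (fun h' => by simpa using (h s hs).1 ⟨m, h'⟩) (by simp)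
    · classical
      let ρ : (ℕ → M.Dom) → ℕ → M.Dom := fun s i => if i < B ∧ i ≠ v then s i else c
      let g : (ℕ → M.Dom) → M.Dom := fun r =>
        if h : ∃ m, TarskiExp M S (Function.update r v m) ψ then h.choose else c
      have e : ∀ s m, TarskiExp M S (Function.update (ρ s) v m) ψ ↔
          TarskiExp M S (Function.update s v m) ψ := fun s m => by
        refine TarskiExp_congr_of_vars hψ' fun x hx => ?_
        by_cases hxv : x = v
        · simp [hxv]
        · have : x < B := hx
          simp [hxv, ρ, this]
      have hg : ∀ s ∈ X, TarskiExp M S (Function.update s v (g (ρ s))) ψ := by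
        intro s hs
        have hex : ∃ m, TarskiExp M S (Function.update (ρ s) v m) ψ := by
          simpa only [e] using (h s hs).2 rfl
        rw [← e]
        simp only [g, dif_pos hex]
        exact hex.choose_spec
      refine TeamSat_ex.2 ⟨(fun s => Function.update s v (g (ρ s))) '' X,
        ⟨fun s hs => ⟨_, s, hs, rfl⟩, ?_⟩, TeamSat_conj.2 ⟨TeamSat_dep_one.2 ?_, ih hψ' ?_ ?_⟩⟩
      · rintro _ ⟨s, hs, rfl⟩
        exact ⟨s, hs, _, rfl⟩
      · rintro _ ⟨s, hs, rfl⟩ _ ⟨s', hs', rfl⟩ hss'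
        have : ρ s = ρ s' := by
          funext x
          by_cases hx : x < B ∧ x ≠ v
          · have := hss' ⟨x, hx.1⟩
            simpa [Term.eval, hx.2, ρ, hx.1] using this
          · simp only [ρ, if_neg hx]
        simp [this]
      · rintro _ ⟨s, hs, rfl⟩
        exact (hcode s hs).update (.inl hv) _
      · rintro _ ⟨s, hs, rfl⟩
        exact iff_of_true (hg s hs) rfl

/-- The variables used as arguments of the encoded relations. -/
def argVars (B A : ℕ) : List ℕ := (List.range A).map (B + 2 + ·)

/-- The variables used as values of the encoded relations. -/
def valueVars (k B A : ℕ) : List ℕ := (List.finRange k).map fun i : Fin k => B + 2 + A + i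

theorem mem_argVars {x : ℕ} : x ∈ argVars B A ↔ B + 2 ≤ x ∧ x < B + 2 + A := by
  simp only [argVars, List.mem_map, List.mem_range]
  exact ⟨by rintro ⟨j, hj, rfl⟩; omega, fun h => ⟨x - (B + 2), by omega, by omega⟩⟩

theorem mem_valueVars {x : ℕ} : x ∈ valueVars k B A ↔ B + 2 + A ≤ x ∧ x < B + 2 + A + k := by
  simp only [valueVars, List.mem_map, List.mem_finRange, true_and]
  exact ⟨by rintro ⟨j, rfl⟩; omega, fun h => ⟨⟨x - (B + 2 + A), by omega⟩, by simp; omega⟩⟩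

/-- There are relations for which the formula is true, for models with at least two elements. -/
def DLFormula.existsRels (B A : ℕ) (ψ : DLFormula (Sig.addRels k ar)) : DLFormula Sig :=
  .ex B <| (DLFormula.dep 0 1 Fin.elim0 fun _ => .var B).conj <|
    .alls (argVars B A) <| .exs (valueVars k B A) <|
    (DLFormula.bigConj <| (List.finRange k).map fun i =>
      .dep (ar i) 1 (fun j => .var (B + 2 + j)) fun _ => .var (B + 2 + A + i)).conj <|
    ψ.uniformEval B A true

theorem TeamSat_existsRels [Nontrivial M.Dom] {ψ : DLFormula (Sig.addRels k ar)}
    (hA : ∀ i, ar i ≤ A) (hFO : ψ.IsFirstOrder) (hψ : ψ.vars ⊆ Set.Iio B) (hfree : ψ.free = ∅)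
    (hX : X.Nonempty) :
    TeamSat M true X (ψ.existsRels B A) ↔ ∃ S, ∀ s, TarskiExp M S s ψ := by
  simp only [DLFormula.existsRels, TeamSat_ex, TeamSat_conj, TeamSat_alls, TeamSat_exs,
    TeamSat_bigConj, List.forall_mem_map, List.mem_finRange, true_implies, TeamSat_dep_one,
    Term.eval]
  constructor
  · rintro ⟨X₁, hsup, hconst, X₃, h₁, h₂, hdep, h⟩
    obtain ⟨s₀, hs₀⟩ := hX
    obtain ⟨m, hm⟩ := hsup.1 s₀ hs₀
    set r := Function.update s₀ B m
    obtain ⟨r', hr', -⟩ := h₁ r ⟨r, hm, eqOff_refl _ _⟩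
    have hB : ∀ s ∈ X₃, s B = r B := by
      intro s hs
      obtain ⟨s₂, ⟨s₁, hs₁, e₁⟩, e₂⟩ := h₂ s hs
      rw [← e₂ B (by rw [mem_valueVars]; omega), ← e₁ B (by rw [mem_argVars]; omega)]
      exact hconst s₁ hs₁ r hm fun i => i.elim0
    let S : ∀ i : Fin k, (Fin (ar i) → M.Dom) → Prop := fun i t =>
      ∃ s ∈ X₃, (∀ j : Fin (ar i), s (B + 2 + j) = t j) ∧ s (B + 2 + A + i) = r B
    refine ⟨S, fun s => ?_⟩
    rw [TarskiExp_congr ψ (s' := r') (by simp [hfree])]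
    refine (TarskiExp_of_uniformEval (c := r B) hA hFO hψ h (fun s hs => ⟨hB s hs, fun i => ?_⟩) ?_
      r' hr').2 rfl
    · refine ⟨fun hi => ⟨s, hs, fun j => rfl, hi⟩, ?_⟩
      rintro ⟨s', hs', e, hi⟩
      rw [← hi]
      exact hdep i s hs s' hs' fun j => (e j).symm
    · intro s hs t
      obtain ⟨s₂, ⟨s₁, hs₁, e₁⟩, e₂⟩ := h₂ s hs
      let s₂' : ℕ → M.Dom := fun x => if x ∈ argVars B A then t (x - (B + 2)) else s₂ x
      obtain ⟨s', hs', e'⟩ := h₁ s₂' ⟨s₁, hs₁, fun x hx => by simp only [s₂', if_neg hx, e₁ x hx]⟩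
      refine ⟨s', hs', fun x hx => ?_, fun j hj => ?_⟩
      · have : x < B := hx
        have hx₁ : x ∉ argVars B A := by rw [mem_argVars]; omega
        have hx₂ : x ∉ valueVars k B A := by rw [mem_valueVars]; omega
        rw [← e₂ x hx₂, ← e' x hx₂]
        simp only [s₂', if_neg hx₁]
      · rw [← e' _ (by rw [mem_valueVars]; omega)]
        have : B + 2 + j ∈ argVars B A := by rw [mem_argVars]; omega
        simp only [s₂', if_pos this, Nat.add_sub_cancel_left]
  · rintro ⟨S, hS⟩
    obtain ⟨a, c, hac⟩ := exists_pair_ne M.Dom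
    classical
    refine ⟨(Function.update · B c) '' X, ⟨fun s hs => ⟨c, s, hs, rfl⟩, ?_⟩, ?_,
      {s' | (∃ s ∈ {s' | ∃ s ∈ (Function.update · B c) '' X, EqOff (argVars B A) s s'},
        EqOff (valueVars k B A) s s') ∧ ∀ i : Fin k,
        s' (B + 2 + A + i) = if S i fun j => s' (B + 2 + j) then c else a}, fun s hs => ?_,
      fun s hs => hs.1, fun i s hs s' hs' e => ?_,
      uniformEval_of_TarskiExp (S := S) (c := c) hac hψ (fun s hs => ⟨?_, fun i => ?_⟩)
        fun s _ => iff_of_true (hS s) rfl⟩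
    · rintro _ ⟨s, hs, rfl⟩
      exact ⟨s, hs, c, rfl⟩
    · rintro _ ⟨s, hs, rfl⟩ _ ⟨s', hs', rfl⟩ -
      simp
    · let s' : ℕ → M.Dom := fun x =>
        if hx : B + 2 + A ≤ x ∧ x < B + 2 + A + k then
          if S ⟨x - (B + 2 + A), by omega⟩ fun j => s (B + 2 + j) then c else a
        else s x
      have hs' : EqOff (valueVars k B A) s s' := fun x hx => by
        rw [mem_valueVars] at hx
        simp only [s', dif_neg hx]
      refine ⟨s', ⟨⟨s, hs, hs'⟩, fun i => ?_⟩, hs'⟩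
      have hi : B + 2 + A ≤ B + 2 + A + i ∧ B + 2 + A + i < B + 2 + A + k := by omega
      have hargs : ∀ j : Fin (ar i), s' (B + 2 + j) = s (B + 2 + j) := fun j =>
        (hs' _ (by rw [mem_valueVars]; have := j.2; have := hA i; omega)).symm
      simp only [hargs]
      simp only [s', dif_pos hi]
      congr!
      simp
    · rw [hs.2 i, hs'.2 i, (funext e : (fun j : Fin (ar i) => s (B + 2 + j)) = _)]
    · obtain ⟨⟨s₂, ⟨_, ⟨s₁, hs₁, rfl⟩, e₁⟩, e₂⟩, -⟩ := hs
      rw [← e₂ B (by rw [mem_valueVars]; omega), ← e₁ B (by rw [mem_argVars]; omega)]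
      simp
    · rw [hs.2 i]
      split_ifs with h <;> simp [h, hac]

/-- The model has only one element. -/
def oneElement : DLFormula Sig := .all 0 (.all 1 (.eq (.var 0) (.var 1)))

theorem Tarski_oneElement {s : ℕ → M.Dom} : Tarski M s oneElement ↔ Subsingleton M.Dom := by
  simp [oneElement, Tarski_all, Tarski, Term.eval, subsingleton_iff]

end Converse

theorem exists_dependence_sentence (k : ℕ) (ar : Fin k → ℕ) (Ψ : DLFormula (Sig.addRels k ar))
    (hFO : Ψ.IsFirstOrder) (hΨ : Ψ.free = ∅) :
    ∃ φ : DLFormula Sig, φ.free = ∅ ∧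
      ∀ M : Model Sig,
        (M.psat true φ ↔
          ∀ (S : ∀ i : Fin k, (Fin (ar i) → M.Dom) → Prop) (s : ℕ → M.Dom),
            Tarski (M.addRels k ar S) s Ψ) := by
  obtain ⟨B, hB⟩ := Ψ.exists_vars_subset_Iio
  obtain ⟨A, hA⟩ : ∃ A, ∀ i, ar i ≤ A :=
    ⟨Finset.univ.sup ar, fun i => Finset.le_sup (Finset.mem_univ i)⟩
  set θ : DLFormula Sig := (oneElement.conj Ψ.neg.someConst).or
    (oneElement.neg.conj (Ψ.neg.existsRels B A))
  obtain ⟨l, hl⟩ := θ.exists_free_alls_eq_empty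
  refine ⟨(θ.alls l).neg, hl, fun M => ?_⟩
  set X : Set (ℕ → M.Dom) := {s' | ∃ s ∈ ({M.defAsg} : Set (ℕ → M.Dom)), EqOff l s s'} with hXdef
  have hX : M.defAsg ∈ X := ⟨_, rfl, eqOff_refl _ _⟩
  have hone : (oneElement : DLFormula Sig).IsFirstOrder := trivial
  have key : TeamSat M true X θ ↔
      ∃ S : ∀ i : Fin k, (Fin (ar i) → M.Dom) → Prop, ∀ s, TarskiExp M S s Ψ.neg := by
    rcases subsingleton_or_nontrivial M.Dom with hM | hM
    · have hXu : X = {M.defAsg} :=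
        Set.eq_singleton_iff_unique_mem.2 ⟨hX, fun s _ => Subsingleton.elim _ _⟩
      have hconst : TeamSat M true X Ψ.neg.someConst ↔
          ∃ S : ∀ i : Fin k, (Fin (ar i) → M.Dom) → Prop, ∀ s, TarskiExp M S s Ψ.neg := by
        rw [TeamSat_iff_forall_Tarski Ψ.neg.isFirstOrder_someConst, hXu]
        simp only [Set.mem_singleton_iff, forall_eq, iff_true, Tarski_someConst]
        exact exists_congr fun S =>
          ⟨fun h s => Subsingleton.elim M.defAsg s ▸ h, fun h => h _⟩
      rw [← hconst]
      constructor
      · rintro ⟨Y, Z, hYZ, hY, hZ⟩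
        have hZ' : Z = ∅ := Set.eq_empty_of_forall_notMem fun s hs =>
          ((TeamSat_iff_forall_Tarski (ψ := oneElement.neg) hone true).1
            (TeamSat_conj.1 hZ).1 s hs).2 rfl (Tarski_oneElement.2 hM)
        rw [hYZ, hZ', Set.union_empty]
        exact (TeamSat_conj.1 hY).2
      · intro h
        refine ⟨X, ∅, by simp, TeamSat_conj.2 ⟨?_, h⟩, TeamSat_empty _⟩
        exact (TeamSat_iff_forall_Tarski hone true).2 fun s _ =>
          iff_of_true (Tarski_oneElement.2 hM) rfl
    · have hM' : ¬ Subsingleton M.Dom := not_subsingleton M.Dom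
      rw [← TeamSat_existsRels (ψ := Ψ.neg) (B := B) hA hFO hB hΨ ⟨_, hX⟩]
      constructor
      · rintro ⟨Y, Z, hYZ, hY, hZ⟩
        have hY' : Y = ∅ := Set.eq_empty_of_forall_notMem fun s hs =>
          hM' (Tarski_oneElement.1 (((TeamSat_iff_forall_Tarski hone true).1
            (TeamSat_conj.1 hY).1 s hs).2 rfl))
        rw [hYZ, hY', Set.empty_union]
        exact (TeamSat_conj.1 hZ).2
      · intro h
        refine ⟨∅, X, by simp, TeamSat_empty _, TeamSat_conj.2 ⟨?_, h⟩⟩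
        exact (TeamSat_iff_forall_Tarski (ψ := oneElement.neg) hone true).2 fun s _ =>
          iff_of_true (fun h => hM' (Tarski_oneElement.1 h)) rfl
  change ¬ TeamSat M true {M.defAsg} (θ.alls l) ↔ ∀ S s, TarskiExp M S s Ψ
  rw [TeamSat_alls, ← hXdef, key]
  simp only [TarskiExp_neg, not_exists, not_forall, not_not]
  refine forall_congr' fun S => ⟨fun ⟨s, h⟩ s' => ?_, fun h => ⟨M.defAsg, h _⟩⟩
  rwa [TarskiExp_congr Ψ (s' := s) (by simp [hΨ])]

/-- Paraconsistent Non-dependence Logic sentences are expressively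
equivalent to Π¹₁ sentences: (1) every Dependence Logic sentence, under
paraconsistent truth, is equivalent to a Π¹₁ sentence `∀R⃗ Ψ`; (2) conversely,
every Π¹₁ sentence is equivalent to the paraconsistent truth of some
Dependence Logic sentence. -/
theorem stmt15 :
    (∀ (Sig : Signature) (φ : DLFormula Sig), φ.free = ∅ →
      ∃ (k : ℕ) (ar : Fin k → ℕ) (Ψ : DLFormula (Sig.addRels k ar)),
        Ψ.IsFirstOrder ∧ Ψ.free = ∅ ∧
        ∀ M : Model Sig,
          (M.psat true φ ↔
            ∀ (S : ∀ i : Fin k, (Fin (ar i) → M.Dom) → Prop) (s : ℕ → M.Dom),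
              Tarski (M.addRels k ar S) s Ψ)) ∧
    (∀ (Sig : Signature) (k : ℕ) (ar : Fin k → ℕ)
        (Ψ : DLFormula (Sig.addRels k ar)),
      Ψ.IsFirstOrder → Ψ.free = ∅ →
      ∃ φ : DLFormula Sig, φ.free = ∅ ∧
        ∀ M : Model Sig,
          (M.psat true φ ↔
            ∀ (S : ∀ i : Fin k, (Fin (ar i) → M.Dom) → Prop) (s : ℕ → M.Dom),
              Tarski (M.addRels k ar S) s Ψ)) := by
  exact ⟨fun _ => exists_universal_sentence, fun _ => exists_dependence_sentence⟩
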